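/- arXiv:1706.05611 — 3 statements merged into one kernel-verified Lean document; each statement's English description precedes it below -/
import Mathlib

section
/- Let G be a finite group, χ an irreducible complex character of G of p-defect zero (i.e., p does not divide |G|/χ(1)), and g ∈ G an element whose order is divisible by p. Then χ(g) = 0. -/
open CategoryTheory

namespace DefectZero
open Polynomial Matrix

lemma charpoly_of_sq {Q : Type*} [Fintype Q] [DecidableEq Q] (E : Matrix Q Q ℂ) (k : ℂ)
    (hk : k ≠ 0) (h : E * E = k • E) :
    ∃ m m0 : ℕ, m + m0 = Fintype.card Q ∧ E.charpoly = (X - C k) ^ m * X ^ m0 ∧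
      E.trace = m * k := by
  have hroots : ∀ r ∈ E.charpoly.roots, r = k ∨ r = 0 := by
    intro r hr
    have h1 : E.charpoly.IsRoot r := Polynomial.isRoot_of_mem_roots hr
    rw [← Matrix.charpoly_toLin', ← Module.End.hasEigenvalue_iff_isRoot_charpoly] at h1
    obtain ⟨v, hv⟩ := h1.exists_hasEigenvector
    have h2 := hv.apply_eq_smul
    rw [Matrix.toLin'_apply] at h2
    have h3 : E *ᵥ (E *ᵥ v) = k • (E *ᵥ v) := by
      rw [Matrix.mulVec_mulVec, h, Matrix.smul_mulVec]
    rw [h2, Matrix.mulVec_smul, h2, smul_smul, smul_smul, ← sub_eq_zero, ← sub_smul] at h3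
    have h4 := (smul_eq_zero.mp h3).resolve_right hv.2
    have h5 : (r - k) * r = 0 := by linear_combination h4
    rcases mul_eq_zero.mp h5 with h6 | h6
    · left; linear_combination h6
    · right; exact h6
  set s := E.charpoly.roots with hs
  have hsplit : s = Multiset.replicate (s.count k) k + Multiset.replicate (s.count 0) 0 := by
    ext a
    rw [Multiset.count_add, Multiset.count_replicate, Multiset.count_replicate]
    by_cases ha : a ∈ s
    · rcases hroots a ha with rfl | rfl
      · simp [hk.symm]
      · simp [hk]
    · rw [Multiset.count_eq_zero_of_notMem ha]
      have := Multiset.count_eq_zero_of_notMem ha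
      split_ifs <;> simp_all
  have hsp : E.charpoly.Splits := IsAlgClosed.splits _
  have hch : E.charpoly = (X - C k) ^ (s.count k) * X ^ (s.count 0) := by
    have h7 := hsp.eq_prod_roots_of_monic E.charpoly_monic
    rw [← hs, hsplit] at h7
    rw [h7]
    simp
  refine ⟨s.count k, s.count 0, ?_, hch, ?_⟩
  · have h8 := E.charpoly_natDegree_eq_dim
    rw [hch, natDegree_mul (pow_ne_zero _ (X_sub_C_ne_zero k)) (pow_ne_zero _ X_ne_zero)] at h8
    simpa using h8
  · rw [Matrix.trace_eq_sum_roots_charpoly, ← hs]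
    conv_lhs => rw [hsplit]
    simp

abbrev AI := integralClosure ℤ ℂ

lemma trace_eq_of_congr {Q : Type*} [Fintype Q] [DecidableEq Q] (P : Ideal AI) [P.IsPrime]
    (k : ℕ) (hk : (k : AI) ∉ P) (E F : Matrix Q Q AI) (hE : E * E = (k : AI) • E)
    (hF : F * F = (k : AI) • F) (h : ∀ i j, E i j - F i j ∈ P) : E.trace = F.trace := by
  have hinj : Function.Injective (algebraMap AI ℂ) := Subtype.val_injective
  have key : ∀ E : Matrix Q Q AI, E * E = (k : AI) • E → ∃ m m0 : ℕ, m + m0 = Fintype.card Q ∧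
      E.charpoly = (X - C (k : AI)) ^ m * X ^ m0 ∧ E.trace = m * k := by
    intro E hE
    have hk0 : (k : ℂ) ≠ 0 := by
      intro h0
      apply hk
      have : k = 0 := by exact_mod_cast h0
      simp [this]
    obtain ⟨m, m0, h1, h2, h3⟩ := charpoly_of_sq (E.map (algebraMap AI ℂ)) k hk0 (by
      rw [← Matrix.map_mul, hE]
      ext i j
      simp)
    refine ⟨m, m0, h1, ?_, ?_⟩
    · apply Polynomial.map_injective _ hinj
      rw [← Matrix.charpoly_map, h2]
      simp
    · apply hinj
      rw [AddMonoidHom.map_trace (algebraMap AI ℂ), h3]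
      simp
  obtain ⟨m, m0, h1, h2, h3⟩ := key E hE
  obtain ⟨n, n0, h4, h5, h6⟩ := key F hF
  have hmap : E.map (Ideal.Quotient.mk P) = F.map (Ideal.Quotient.mk P) := by
    ext i j
    exact (Ideal.Quotient.mk_eq_mk_iff_sub_mem _ _).mpr (h i j)
  have h7 := congrArg Matrix.charpoly hmap
  rw [Matrix.charpoly_map, Matrix.charpoly_map, h2, h5] at h7
  simp only [Polynomial.map_mul, Polynomial.map_pow, Polynomial.map_sub, map_X, map_C] at h7
  have hk' : (Ideal.Quotient.mk P) (k : AI) ≠ 0 := by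
    rwa [Ne, Ideal.Quotient.eq_zero_iff_mem]
  have h8 := congrArg (rootMultiplicity 0) h7
  have aux : ∀ a b : ℕ, rootMultiplicity 0
      ((X - C ((Ideal.Quotient.mk P) (k : AI))) ^ a * X ^ b) = b := by
    intro a b
    rw [rootMultiplicity_mul (mul_ne_zero (pow_ne_zero _ (X_sub_C_ne_zero _))
      (pow_ne_zero _ X_ne_zero))]
    rw [rootMultiplicity_eq_zero (by
      intro h
      simp only [IsRoot, eval_pow, eval_sub, eval_X, eval_C, zero_sub] at h
      exact pow_ne_zero a (neg_ne_zero.mpr hk') h)]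
    have := rootMultiplicity_X_sub_C_pow (0 : AI ⧸ P) b
    simpa using this
  rw [aux, aux] at h8
  rw [h3, h6]
  congr 2
  omega

lemma exists_prime (p : ℕ) (hp : p.Prime) : ∃ P : Ideal AI, P.IsMaximal ∧ (p : AI) ∈ P := by
  have hne : Ideal.span {(p : AI)} ≠ ⊤ := by
    rw [Ne, Ideal.span_singleton_eq_top]
    intro hu
    obtain ⟨x, hx⟩ := hu.exists_right_inv
    have hx' : (p : ℂ) * (x : ℂ) = 1 := by
      have := congrArg (Subtype.val) hx
      simpa using this
    have hx2 : (x : ℂ) = algebraMap ℚ ℂ (1 / p) := by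
      have : (p : ℂ) ≠ 0 := by exact_mod_cast hp.ne_zero
      simp
      field_simp
      linear_combination hx'
    have hi : IsIntegral ℤ (x : ℂ) := x.2
    rw [hx2, isIntegral_algebraMap_iff (algebraMap ℚ ℂ).injective] at hi
    obtain ⟨y, hy⟩ := IsIntegrallyClosed.isIntegral_iff.mp hi
    have hp0 : (p : ℚ) ≠ 0 := by exact_mod_cast hp.ne_zero
    have h9 : (p : ℚ) * y = 1 := by
      simp at hy
      rw [hy]; field_simp
    have h10 : (p : ℤ) * y = 1 := by exact_mod_cast h9
    have h11 : IsUnit (p : ℤ) := IsUnit.of_mul_eq_one _ h10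
    rw [Int.isUnit_iff] at h11
    have := hp.two_le
    omega
  obtain ⟨P, hP, hle⟩ := Ideal.exists_le_maximal _ hne
  exact ⟨P, hP, hle (Ideal.mem_span_singleton_self _)⟩

variable {G : Type} [Group G] [Fintype G]

open Classical in
/-- The matrix of right multiplication by a class function on the induced module. -/
noncomputable def indMat (H : Subgroup G) (χ : G → AI) (μ : H →* AI) :
    Matrix (G ⧸ H) (G ⧸ H) AI :=
  fun s t => ∑ h : H, μ h * χ (Quotient.out s * h * (Quotient.out t)⁻¹)

open Classical in
lemma indMat_sq (H : Subgroup G) (χ : G → AI) (μ : H →* AI) (k : ℕ)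
    (hconv : ∀ w v, ∑ x : G, χ (w * x⁻¹) * χ (x * v) = k * χ (w * v)) :
    indMat H χ μ * indMat H χ μ = (k : AI) • indMat H χ μ := by
  ext1 s r
  have e : Function.Bijective (fun q : (G ⧸ H) × H => (Quotient.out q.1 : G) * (q.2 : G)⁻¹) := by
    rw [Fintype.bijective_iff_injective_and_card]
    refine ⟨?_, ?_⟩
    · rintro ⟨a, b⟩ ⟨c, d⟩ h
      simp only at h
      have hac : a = c := by
        have := congrArg (QuotientGroup.mk : G → G ⧸ H) h
        rw [QuotientGroup.mk_mul_of_mem _ (H.inv_mem b.2),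
          QuotientGroup.mk_mul_of_mem _ (H.inv_mem d.2)] at this
        simpa using this
      subst hac
      have := mul_left_cancel h
      rw [_root_.inv_inj] at this
      exact Prod.ext rfl (Subtype.ext this)
    · rw [← Nat.card_eq_fintype_card, ← Nat.card_eq_fintype_card, Nat.card_prod]
      exact (Subgroup.card_eq_card_quotient_mul_card_subgroup H).symm
  rw [Matrix.mul_apply, Matrix.smul_apply]
  simp only [indMat]
  calc _ = ∑ t : G ⧸ H, ∑ h : H, ∑ l : H, μ l *
        (χ (Quotient.out s * (Quotient.out t * (h:G)⁻¹)⁻¹) *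
          χ ((Quotient.out t * (h:G)⁻¹) * (l * (Quotient.out r)⁻¹))) := by
        refine Finset.sum_congr rfl fun t _ => ?_
        rw [Finset.sum_mul_sum]
        refine Finset.sum_congr rfl fun h _ => ?_
        refine Fintype.sum_equiv (Equiv.mulLeft h) _ _ fun j => ?_
        simp only [Equiv.coe_mulLeft, map_mul, Subgroup.coe_mul, _root_.mul_inv_rev, inv_inv, mul_assoc,
          inv_mul_cancel_left]
        ring
    _ = ∑ l : H, μ l * ∑ x : G, (χ (Quotient.out s * x⁻¹) * χ (x * (l * (Quotient.out r)⁻¹))) := by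
        rw [← Fintype.sum_prod_type' (f := fun (t : G ⧸ H) (h : H) => ∑ l : H, μ l *
        (χ (Quotient.out s * (Quotient.out t * (h:G)⁻¹)⁻¹) *
          χ ((Quotient.out t * (h:G)⁻¹) * (l * (Quotient.out r)⁻¹))))]
        rw [Finset.sum_comm]
        refine Finset.sum_congr rfl fun l _ => ?_
        rw [← Finset.mul_sum]
        congr 1
        exact e.sum_comp (fun x => χ (Quotient.out s * x⁻¹) * χ (x * (l * (Quotient.out r)⁻¹)))
    _ = _ := by
        rw [smul_eq_mul, Finset.mul_sum]
        refine Finset.sum_congr rfl fun l _ => ?_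
        rw [hconv, ← mul_assoc (Quotient.out s)]
        ring

open Classical in
lemma indMat_trace (H : Subgroup G) (χ : G → AI) (μ : H →* AI)
    (hconj : ∀ x y, χ (x * y * x⁻¹) = χ y) :
    (indMat H χ μ).trace = (Fintype.card (G ⧸ H) : AI) * ∑ h : H, μ h * χ h := by
  simp [Matrix.trace, indMat, hconj]

open Classical in
lemma core (p : ℕ) (hp : p.Prime) (χ : G → AI) (k : ℕ) (hk : ¬ p ∣ k)
    (hconv : ∀ w v, ∑ x : G, χ (w * x⁻¹) * χ (x * v) = k * χ (w * v))
    (hconj : ∀ x y, χ (x * y * x⁻¹) = χ y) (g : G) (hg : p ∣ orderOf g) : χ g = 0 := by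
  obtain ⟨P, hP, hpP⟩ := exists_prime p hp
  have hPp := hP.isPrime
  have hkP : (k : AI) ∉ P := by
    intro hkP
    have hco : Nat.Coprime p k := (Nat.Prime.coprime_iff_not_dvd hp).mpr hk
    have : IsCoprime ((p : ℤ)) (k : ℤ) := Nat.isCoprime_iff_coprime.mpr hco
    obtain ⟨a, b, hab⟩ := this
    apply hPp.ne_top
    rw [Ideal.eq_top_iff_one]
    have h1 : (a : AI) * (p : AI) + b * (k : AI) = 1 := by exact_mod_cast congrArg (Int.cast : ℤ → AI) hab
    rw [← h1]
    exact P.add_mem (P.mul_mem_left _ hpP) (P.mul_mem_left _ hkP)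
  set n := orderOf g with hn
  have hn0 : 0 < n := orderOf_pos g
  haveI : NeZero n := ⟨hn0.ne'⟩
  have hinj : Function.Injective (algebraMap AI ℂ) := Subtype.val_injective
  -- primitive root
  have hz := Complex.isPrimitiveRoot_exp n hn0.ne'
  obtain ⟨z, hzz⟩ : ∃ z : AI, algebraMap AI ℂ z = Complex.exp (2 * Real.pi * Complex.I / n) :=
    ⟨⟨_, hz.isIntegral hn0⟩, rfl⟩
  have hzp : IsPrimitiveRoot z n := by
    rw [← hzz] at hz
    exact hz.of_map_of_injective hinj
  obtain ⟨u, hu⟩ := hzp.isUnit hn0.ne'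
  have hup : IsPrimitiveRoot u n := by
    rw [← hu] at hzp
    exact IsPrimitiveRoot.coe_units_iff.mp hzp
  set w : AIˣ := u ^ (n / p) with hw
  have hwp : IsPrimitiveRoot w p := hup.pow hn0 (Nat.div_mul_cancel hg).symm
  have hw1 : Ideal.Quotient.mk P (w : AI) = 1 := by
    haveI := Fact.mk hp
    haveI : CharP (AI ⧸ P) p := by
      refine (CharP.charP_iff_prime_eq_zero hp).mpr ?_
      rw [← map_natCast (Ideal.Quotient.mk P)]
      exact Ideal.Quotient.eq_zero_iff_mem.mpr hpP
    apply frobenius_inj (AI ⧸ P) p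
    rw [frobenius_def, frobenius_def, ← map_pow, ← Units.val_pow_eq_pow_val, hwp.pow_eq_one]
    simp
  let H := Subgroup.zpowers g
  let g0 : H := ⟨g, Subgroup.mem_zpowers g⟩
  have hg0 : ∀ x : H, x ∈ Subgroup.zpowers g0 := by
    rintro ⟨x, i, rfl⟩
    exact ⟨i, rfl⟩
  have hg0n : orderOf g0 = n := Subgroup.orderOf_mk g _
  -- homs
  have hhom : ∀ v : AIˣ, v ^ n = 1 → ∃ μ : H →* AI, ∀ i : ℕ, μ (g0 ^ i) = (v : AI) ^ i := by
    intro v hv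
    refine ⟨(Units.coeHom AI).comp (monoidHomOfForallMemZpowers hg0 (g' := v)
      (by rw [hg0n]; exact orderOf_dvd_of_pow_eq_one hv)), fun i => ?_⟩
    rw [map_pow, MonoidHom.comp_apply, monoidHomOfForallMemZpowers_apply_gen]
    rfl
  have hsum : ∀ (v : AI) (μ : H →* AI), (∀ i : ℕ, μ (g0 ^ i) = v ^ i) →
      ∑ h : H, μ h * χ h = ∑ i ∈ Finset.range n, v ^ i * χ (g ^ i) := by
    intro v μ hμ
    rw [← Fin.sum_univ_eq_sum_range (fun i => v ^ i * χ (g ^ i))]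
    symm
    refine Fintype.sum_equiv (finEquivZPowers (isOfFinOrder_of_finite g)) _ _ fun i => ?_
    have : finEquivZPowers (isOfFinOrder_of_finite g) i = g0 ^ (i : ℕ) := by
      rw [finEquivZPowers_apply]; rfl
    rw [this, hμ]
    rfl
  have hmain : ∀ v : AIˣ, v ^ n = 1 → ∑ i ∈ Finset.range n, (v : AI) ^ i * χ (g ^ i) =
      ∑ i ∈ Finset.range n, ((v * w : AIˣ) : AI) ^ i * χ (g ^ i) := by
    intro v hv
    have hvw : (v * w) ^ n = 1 := by
      rw [mul_pow, hv, one_mul, hw, ← pow_mul, mul_comm, pow_mul, hup.pow_eq_one, one_pow]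
    obtain ⟨μ, hμ⟩ := hhom v hv
    obtain ⟨μ', hμ'⟩ := hhom _ hvw
    have ht := trace_eq_of_congr P k hkP (indMat H χ μ) (indMat H χ μ')
      (indMat_sq H χ μ k hconv) (indMat_sq H χ μ' k hconv) (by
        intro i j
        rw [← Ideal.Quotient.mk_eq_mk_iff_sub_mem]
        simp only [indMat, map_sum, map_mul]
        refine Finset.sum_congr rfl fun h _ => ?_
        congr 1
        obtain ⟨m, rfl⟩ := (mem_zpowers_iff_mem_range_orderOf.mp (hg0 h) |> Finset.mem_image.mp).imp
          fun _ hh => hh.2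
        rw [hμ, hμ']
        simp [hw1])
    rw [indMat_trace _ _ _ hconj, indMat_trace _ _ _ hconj] at ht
    have hc : (Fintype.card (G ⧸ H) : AI) ≠ 0 := by
      exact_mod_cast Fintype.card_ne_zero
    rw [← hsum _ μ hμ, ← hsum _ μ' hμ']
    exact mul_left_cancel₀ hc ht
  let F : AI[X] := ∑ i ∈ Finset.range n, C ((1 - (w : AI) ^ i) * χ (g ^ i)) * X ^ i
  have hF : F = 0 := by
    have hdeg : F.degree < n := by
      refine lt_of_le_of_lt (Polynomial.degree_sum_le _ _) ?_
      rw [Finset.sup_lt_iff (by exact_mod_cast WithBot.bot_lt_coe n)]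
      intro i hi
      refine lt_of_le_of_lt (degree_C_mul_X_pow_le _ _) ?_
      exact_mod_cast Finset.mem_range.mp hi
    refine Polynomial.eq_zero_of_degree_lt_of_eval_finset_eq_zero
      (Polynomial.nthRootsFinset n (1 : AI)) ?_ ?_
    · rw [hzp.card_nthRootsFinset]; exact hdeg
    · intro x hx
      rw [Polynomial.mem_nthRootsFinset hn0] at hx
      have hxu : IsUnit x := IsUnit.of_pow_eq_one hx hn0.ne'
      obtain ⟨v, rfl⟩ := hxu
      have hv : v ^ n = 1 := Units.ext (by simpa using hx)
      have := hmain v hv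
      rw [← sub_eq_zero, ← Finset.sum_sub_distrib] at this
      rw [← this]
      simp only [F, eval_finsetSum, eval_mul, eval_C, eval_pow, eval_X]
      refine Finset.sum_congr rfl fun i _ => ?_
      rw [Units.val_mul, mul_pow]
      ring
  have h1n : 1 < n := lt_of_lt_of_le hp.one_lt (Nat.le_of_dvd hn0 hg)
  have hcoef : F.coeff 1 = (1 - (w : AI)) * χ g := by
    simp only [F, finsetSum_coeff, coeff_C_mul_X_pow]
    rw [Finset.sum_ite_eq]
    simp [h1n]
  rw [hF, coeff_zero] at hcoef
  refine (mul_eq_zero.mp hcoef.symm).resolve_left ?_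
  intro h0
  apply hwp.ne_one hp.one_lt
  apply Units.ext
  rw [Units.val_one]
  linear_combination -h0

lemma char_isIntegral (V : FDRep ℂ G) (g : G) : IsIntegral ℤ (V.character g) := by
  unfold FDRep.character
  rw [Module.End.trace_eq_sum_roots_charpoly_of_splits (IsAlgClosed.splits _)]
  apply IsIntegral.multiset_sum
  intro r hr
  have h1 := Polynomial.isRoot_of_mem_roots hr
  rw [← Module.End.hasEigenvalue_iff_isRoot_charpoly] at h1
  obtain ⟨v, hv⟩ := h1.exists_hasEigenvector
  have h2 := hv.pow_apply (orderOf g)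
  rw [← map_pow, pow_orderOf_eq_one, map_one, Module.End.one_apply] at h2
  have h3 : (r ^ orderOf g - 1) • v = 0 := by rw [sub_smul, ← h2, one_smul, sub_self]
  have h4 := (smul_eq_zero.mp h3).resolve_right hv.2
  refine IsIntegral.of_pow (orderOf_pos g) ?_
  rw [sub_eq_zero.mp h4]
  exact isIntegral_one

lemma schur (V : FDRep ℂ G) (hV : Simple V) (f : V →ₗ[ℂ] V)
    (hf : ∀ g, V.ρ g ∘ₗ f = f ∘ₗ V.ρ g) : ∃ c : ℂ, f = c • LinearMap.id := by
  have h1 : Module.finrank ℂ (Representation.invariants (Representation.linHom V.ρ V.ρ)) = 1 := by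
    rw [LinearEquiv.finrank_eq (Representation.linHom.invariantsEquivFDRepHom V V)]
    exact finrank_endomorphism_simple_eq_one ℂ V
  have hmem : ∀ f : V →ₗ[ℂ] V, (∀ g, V.ρ g ∘ₗ f = f ∘ₗ V.ρ g) →
      f ∈ Representation.invariants (Representation.linHom V.ρ V.ρ) := by
    intro f hf
    rw [Representation.mem_invariants]
    intro g
    rw [Representation.linHom_apply, ← LinearMap.comp_assoc, hf, LinearMap.comp_assoc]
    change f * (V.ρ g * V.ρ g⁻¹) = f
    rw [← map_mul]; simp
  by_cases h0 : (LinearMap.id : V →ₗ[ℂ] V) = 0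
  · refine ⟨0, ?_⟩
    have : f = f ∘ₗ LinearMap.id := rfl
    rw [this, h0]; simp
  · have := (finrank_eq_one_iff_of_nonzero' (⟨LinearMap.id, hmem _ fun _ => rfl⟩ :
      Representation.invariants (Representation.linHom V.ρ V.ρ))
      (fun h => h0 (congrArg Subtype.val h))).mp h1 ⟨f, hmem f hf⟩
    obtain ⟨c, hc⟩ := this
    exact ⟨c, (congrArg Subtype.val hc).symm⟩

lemma conv (V : FDRep ℂ G) (hV : Simple V) : ∃ c : ℂ,
    c * Module.finrank ℂ V = Fintype.card G ∧
    ∀ v, ∑ x : G, V.character x⁻¹ * V.character (x * v) = c * V.character v := by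
  let f : V →ₗ[ℂ] V := ∑ x : G, V.character x⁻¹ • V.ρ x
  obtain ⟨c, hc⟩ := schur V hV f (by
    intro g
    change V.ρ g * f = f * V.ρ g
    simp only [f, Finset.mul_sum, Finset.sum_mul, mul_smul_comm, smul_mul_assoc, ← map_mul]
    refine Fintype.sum_equiv (MulAut.conj g).toEquiv _ _ fun x => ?_
    simp only [MulEquiv.toEquiv_eq_coe, EquivLike.coe_coe, MulAut.conj_apply]
    congr 1
    · rw [← V.char_conj x⁻¹ g]
      simp [mul_assoc]
    · simp [mul_assoc])
  have hv : ∀ v, ∑ x : G, V.character x⁻¹ * V.character (x * v) = c * V.character v := by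
    intro v
    have h1 : f * V.ρ v = c • V.ρ v := by rw [hc]; rfl
    have h2 := congrArg (LinearMap.trace ℂ V) h1
    simp only [f, Finset.sum_mul, smul_mul_assoc, ← map_mul, map_sum, map_smul, smul_eq_mul] at h2
    exact h2
  refine ⟨c, ?_, hv⟩
  have h1 := hv 1
  rw [FDRep.char_one] at h1
  rw [← h1]
  haveI : Invertible (Nat.card G : ℂ) := invertibleOfNonzero (by
    exact_mod_cast Nat.card_pos.ne')
  have h2 := FDRep.char_orthonormal V V
  rw [if_pos ⟨Iso.refl V⟩] at h2
  have h3 : (Nat.card G : ℂ) ≠ 0 := by exact_mod_cast Nat.card_pos.ne'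
  field_simp at h2
  rw [Nat.card_eq_fintype_card] at h2
  simp only [mul_one]
  rw [← mul_one (Fintype.card G : ℂ)]
  simpa [mul_comm] using h2

lemma conv_int (V : FDRep ℂ G) (hV : Simple V) : ∃ k : ℕ,
    k * Module.finrank ℂ V = Fintype.card G ∧
    ∀ v, ∑ x : G, V.character x⁻¹ * V.character (x * v) = k * V.character v := by
  obtain ⟨c, hc, hv⟩ := conv V hV
  have hcard : (Fintype.card G : ℂ) ≠ 0 := by exact_mod_cast Fintype.card_ne_zero
  have hd : (Module.finrank ℂ V : ℂ) ≠ 0 := by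
    intro h; rw [h, mul_zero] at hc; exact hcard hc.symm
  have hint : IsIntegral AI c := by
    refine isIntegral_of_smul_mem_submodule (M := ℂ)
      (Submodule.span AI (Set.range V.character)) ?_
      (Submodule.fg_span (Set.finite_range _)) c ?_
    · intro h
      have h1 : V.character 1 ∈ Submodule.span AI (Set.range V.character) :=
        Submodule.subset_span ⟨1, rfl⟩
      rw [h, Submodule.mem_bot, FDRep.char_one] at h1
      exact hd h1
    · intro n hn
      induction hn using Submodule.span_induction with
      | mem x hx =>
        obtain ⟨v, rfl⟩ := hx
        rw [smul_eq_mul, ← hv]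
        refine Submodule.sum_mem _ fun x _ => ?_
        exact Submodule.smul_mem _ (⟨_, char_isIntegral V x⁻¹⟩ : AI)
          (Submodule.subset_span ⟨x * v, rfl⟩)
      | zero => simp
      | add x y _ _ hx hy => rw [smul_add]; exact Submodule.add_mem _ hx hy
      | smul a x _ hx => rw [smul_comm]; exact Submodule.smul_mem _ _ hx
  have hint' : IsIntegral ℤ c := isIntegral_trans c hint
  have hcq : c = algebraMap ℚ ℂ (Fintype.card G / Module.finrank ℂ V) := by
    simp
    field_simp
    exact hc
  rw [hcq, isIntegral_algebraMap_iff (algebraMap ℚ ℂ).injective] at hint'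
  obtain ⟨y, hy⟩ := IsIntegrallyClosed.isIntegral_iff.mp hint'
  have hy0 : 0 ≤ y := by
    have : (0 : ℚ) ≤ algebraMap ℤ ℚ y := by rw [hy]; positivity
    simpa using this
  obtain ⟨k, rfl⟩ := Int.eq_ofNat_of_zero_le hy0
  have hck : c = k := by
    rw [hcq, ← hy]; simp
  refine ⟨k, ?_, fun v => by rw [← hck]; exact hv v⟩
  rw [hck] at hc
  exact_mod_cast hc

end DefectZero

theorem stmt_4 {G : Type} [Group G] [Fintype G] (p : ℕ) (hp : p.Prime)
    (V : FDRep ℂ G) (hV : Simple V)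
    (hdefect : ¬ p ∣ (Fintype.card G / Module.finrank ℂ V))
    (g : G) (hg : p ∣ orderOf g) :
    V.character g = 0 := by
  obtain ⟨k, hk, hv⟩ := DefectZero.conv_int V hV
  have hd : 0 < Module.finrank ℂ V := by
    rcases Nat.eq_zero_or_pos (Module.finrank ℂ V) with h | h
    · rw [h, mul_zero] at hk
      exact absurd hk.symm Fintype.card_ne_zero
    · exact h
  rw [← hk, Nat.mul_div_cancel _ hd] at hdefect
  have := DefectZero.core p hp
    (fun x => (⟨V.character x, DefectZero.char_isIntegral V x⟩ : DefectZero.AI)) k hdefect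
    (by
      intro w v
      apply Subtype.ext
      push_cast
      rw [← hv (w * v)]
      refine Fintype.sum_equiv (Equiv.mulRight w⁻¹) _ _ fun x => ?_
      simp [mul_assoc])
    (by
      intro x y
      apply Subtype.ext
      exact V.char_conj y x) g hg
  exact congrArg Subtype.val this
end

section
/- Let n ≥ 7 and t ≥ 2 be integers, and let x be an even permutation of {1,…,n} whose cycle type (including fixed points) is (t,…,t) or (t,…,t,1). Then there exists an irreducible complex character θ of the alternating group Alt(n) such that θ extends to an irreducible character of Sym(n) and θ(x) = 0. -/
open CategoryTheory

theorem trace_sub_quot {V : Type} [AddCommGroup V] [Module ℂ V] [FiniteDimensional ℂ V]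
    (N : Submodule ℂ V) (f : V →ₗ[ℂ] V) (hf : N ≤ N.comap f) :
    LinearMap.trace ℂ V f = LinearMap.trace ℂ N (f.restrict hf) +
      LinearMap.trace ℂ (V ⧸ N) (N.mapQ N f hf) := by
  obtain ⟨s, hs⟩ := N.mkQ.exists_rightInverse_of_surjective (by simp)
  have hmem : ∀ v, v - s (N.mkQ v) ∈ N := by
    intro v
    rw [← Submodule.Quotient.mk_eq_zero, ← Submodule.mkQ_apply, map_sub]
    have := LinearMap.congr_fun hs (N.mkQ v)
    simp only [LinearMap.comp_apply, LinearMap.id_apply] at this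
    rw [this, sub_self]
  have e1 : f = f ∘ₗ (LinearMap.id - s ∘ₗ N.mkQ) + (f ∘ₗ s) ∘ₗ N.mkQ := by
    ext v; simp
  have h1 : ∀ v, (f ∘ₗ (LinearMap.id - s ∘ₗ N.mkQ)) v ∈ N := fun v => hf (hmem v)
  have e2 : LinearMap.trace ℂ V (f ∘ₗ (LinearMap.id - s ∘ₗ N.mkQ)) =
      LinearMap.trace ℂ N (f.restrict hf) := by
    rw [← LinearMap.trace_restrict_eq_of_forall_mem N _ h1]
    congr 1
    ext ⟨v, hv⟩
    have : (Submodule.Quotient.mk v : V ⧸ N) = 0 := (Submodule.Quotient.mk_eq_zero N).2 hv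
    simp [LinearMap.restrict_apply, this]
  have e3 : LinearMap.trace ℂ V ((f ∘ₗ s) ∘ₗ N.mkQ) =
      LinearMap.trace ℂ (V ⧸ N) (N.mapQ N f hf) := by
    rw [LinearMap.trace_comp_comm']
    congr 1
    apply LinearMap.ext
    intro q
    have := LinearMap.congr_fun hs q
    simp only [LinearMap.comp_apply, LinearMap.id_apply] at this
    simp only [LinearMap.comp_apply]
    conv_rhs => rw [← this]
    simp
  conv_lhs => rw [e1]
  rw [map_add, e2, e3]

section
variable {G : Type} [Group G] [Fintype G]

theorem hom_sum {V W : Type} [AddCommGroup V] [Module ℂ V] [FiniteDimensional ℂ V]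
    [AddCommGroup W] [Module ℂ W] [FiniteDimensional ℂ W]
    (ρ : Representation ℂ G V) (σ : Representation ℂ G W) :
    ∑ g : G, σ.character g * ρ.character g⁻¹ =
      (Fintype.card G : ℂ) * Module.finrank ℂ (Representation.IntertwiningMap ρ σ) := by
  have h0 : (Nat.card G : ℂ) ≠ 0 := by simp
  have : Invertible (Nat.card G : ℂ) := invertibleOfNonzero h0
  rw [← Representation.card_inv_mul_sum_char_mul_char_eq_finrank, ← Nat.card_eq_fintype_card,
    mul_inv_cancel_left₀ h0]

theorem hom_sum' {V W : Type} [AddCommGroup V] [Module ℂ V] [FiniteDimensional ℂ V]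
    [AddCommGroup W] [Module ℂ W] [FiniteDimensional ℂ W]
    (ρ : Representation ℂ G V) (σ : Representation ℂ G W) :
    ∑ g : G, ρ.character g * σ.character g⁻¹ =
      (Fintype.card G : ℂ) * Module.finrank ℂ (Representation.IntertwiningMap ρ σ) := by
  rw [← hom_sum]
  refine Fintype.sum_equiv (Equiv.inv G) _ _ ?_
  intro g; simp [mul_comm]

theorem virt (d : ℕ) : ∀ {V W : Type} [AddCommGroup V] [Module ℂ V] [FiniteDimensional ℂ V]
    [AddCommGroup W] [Module ℂ W] [FiniteDimensional ℂ W]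
    (ρ : Representation ℂ G V) (σ : Representation ℂ G W),
    Module.finrank ℂ W = d →
    ∑ g : G, (ρ.character g - σ.character g) * (ρ.character g⁻¹ - σ.character g⁻¹) =
      (Fintype.card G : ℂ) →
    Module.finrank ℂ W < Module.finrank ℂ V →
    ∃ Θ : FDRep ℂ G, ∀ g, Θ.character g = ρ.character g - σ.character g := by
  induction d using Nat.strong_induction_on with
  | _ d ih =>
  intro V W _ _ _ _ _ _ ρ σ hd hsum hlt
  by_cases hz : ∀ f : Representation.IntertwiningMap ρ σ, f = 0
  · have hs : Subsingleton (Representation.IntertwiningMap ρ σ) :=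
      ⟨fun a b => by rw [hz a, hz b]⟩
    have hr : Module.finrank ℂ (Representation.IntertwiningMap ρ σ) = 0 :=
      Module.finrank_zero_of_subsingleton
    have key : (Fintype.card G : ℂ) * Module.finrank ℂ (Representation.IntertwiningMap ρ ρ) +
      (Fintype.card G : ℂ) * Module.finrank ℂ (Representation.IntertwiningMap σ σ) =
        Fintype.card G := by
      rw [← hom_sum, ← hom_sum]; refine Eq.trans ?_ hsum
      have a := hom_sum ρ σ
      have b := hom_sum' ρ σ
      rw [hr] at a b
      simp only [sub_mul, mul_sub, Finset.sum_sub_distrib, a, b]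
      push_cast
      ring
    have key2 : Module.finrank ℂ (Representation.IntertwiningMap ρ ρ) +
      Module.finrank ℂ (Representation.IntertwiningMap σ σ) = 1 := by
      have h0 : (Fintype.card G : ℂ) ≠ 0 := by simp
      rw [← mul_add] at key
      have := mul_left_cancel₀ h0 (key.trans (mul_one _).symm)
      exact_mod_cast this
    have : Module.finrank ℂ (Representation.IntertwiningMap ρ ρ) ≠ 0 := by
      intro h0
      have := Module.finrank_zero_iff.1 h0
      have h1 : (Representation.IntertwiningMap.id ρ) = 0 := Subsingleton.elim _ _
      have : Subsingleton V := ⟨fun a b => by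
        have ha := congrArg (fun f => f a) h1
        have hb := congrArg (fun f => f b) h1
        simp at ha hb
        rw [ha, hb]⟩
      have := Module.finrank_zero_of_subsingleton (R := ℂ) (M := V)
      omega
    have h0 : Module.finrank ℂ (Representation.IntertwiningMap σ σ) = 0 := by omega
    have := Module.finrank_zero_iff.1 h0
    have h1 : (Representation.IntertwiningMap.id σ) = 0 := Subsingleton.elim _ _
    have : Subsingleton W := ⟨fun a b => by
        have ha := congrArg (fun f => f a) h1
        have hb := congrArg (fun f => f b) h1
        simp at ha hb
        rw [ha, hb]⟩
    refine ⟨FDRep.of ρ, fun g => ?_⟩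
    have : σ.character g = 0 := by
      unfold Representation.character
      rw [Subsingleton.elim (σ g) 0, map_zero]
    rw [this, sub_zero]
    rfl
  · push Not at hz
    obtain ⟨f, hf⟩ := hz
    let F : V →ₗ[ℂ] W := f.toLinearMap
    have hF : ∀ g v, F (ρ g v) = σ g (F v) := fun g v => by
      have := f.isIntertwining' g
      exact LinearMap.congr_fun this v
    have hk : ∀ g, LinearMap.ker F ≤ (LinearMap.ker F).comap (ρ g) := by
      intro g v hv
      simp only [Submodule.mem_comap, LinearMap.mem_ker] at hv ⊢
      rw [hF, hv, map_zero]
    have hr : ∀ g, LinearMap.range F ≤ (LinearMap.range F).comap (σ g) := by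
      rintro g _ ⟨v, rfl⟩
      exact ⟨ρ g v, hF g v⟩
    let ρ' := ρ.subrepresentation (LinearMap.ker F) hk
    let σ' := σ.quotient (LinearMap.range F) hr
    have hch : ∀ g, ρ'.character g - σ'.character g = ρ.character g - σ.character g := by
      intro g
      have a := trace_sub_quot (LinearMap.ker F) (ρ g) (hk g)
      have b := trace_sub_quot (LinearMap.range F) (σ g) (hr g)
      have c : LinearMap.trace ℂ _ ((LinearMap.range F).mapQ (LinearMap.range F) (σ g) (hr g)) =
        σ'.character g := rfl
      have c' : LinearMap.trace ℂ _ ((ρ g).restrict (hk g)) = ρ'.character g := rfl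
      have d' : LinearMap.trace ℂ _ ((LinearMap.ker F).mapQ (LinearMap.ker F) (ρ g) (hk g)) =
          LinearMap.trace ℂ _ ((σ g).restrict (hr g)) := by
        rw [← LinearMap.trace_conj' _ F.quotKerEquivRange]
        congr 1
        apply LinearMap.ext
        rintro ⟨_, v, rfl⟩
        apply Subtype.ext
        have : F.quotKerEquivRange.symm ⟨F v, ⟨v, rfl⟩⟩ = Submodule.Quotient.mk v := by
          rw [LinearEquiv.symm_apply_eq]; rfl
        rw [LinearEquiv.conj_apply_apply, this]
        simp [LinearMap.restrict_apply, hF]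
      unfold Representation.character at *
      rw [a, b, c, c', d']
      ring
    have hne : F ≠ 0 := by
      intro h
      apply hf
      ext v
      exact LinearMap.congr_fun h v
    have hpos : 0 < Module.finrank ℂ (LinearMap.range F) := by
      rw [Module.finrank_pos_iff, Submodule.nontrivial_iff_ne_bot]
      simpa [LinearMap.range_eq_bot] using hne
    have hn1 := Submodule.finrank_quotient_add_finrank (LinearMap.range F)
    have hn2 := LinearMap.finrank_range_add_finrank_ker F
    obtain ⟨Θ, hΘ⟩ := ih (Module.finrank ℂ (W ⧸ LinearMap.range F)) (by omega) ρ' σ' rfl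
      (by simp_rw [hch]; exact hsum) (by omega)
    exact ⟨Θ, fun g => (hΘ g).trans (hch g)⟩

end

theorem reduce (n : ℕ) (hn : 7 ≤ n) {V W : Type}
    [AddCommGroup V] [Module ℂ V] [FiniteDimensional ℂ V]
    [AddCommGroup W] [Module ℂ W] [FiniteDimensional ℂ W]
    (ρ : Representation ℂ (Equiv.Perm (Fin n)) V) (σ : Representation ℂ (Equiv.Perm (Fin n)) W)
    (φ : Equiv.Perm (Fin n) → ℝ) (hφ : ∀ g, ρ.character g - σ.character g = (φ g : ℂ))
    (hinv : ∀ g, φ g⁻¹ = φ g)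
    (hsum : ∑ g, φ g ^ 2 = (Nat.factorial n : ℝ)) (hpos : 0 < φ 1)
    (s : Equiv.Perm (Fin n)) (hs : s ∉ alternatingGroup (Fin n)) (hsφ : φ s ≠ 0)
    (x : Equiv.Perm (Fin n)) (hx : x ∈ alternatingGroup (Fin n)) (hxφ : φ x = 0) :
    ∃ θ : FDRep ℂ (alternatingGroup (Fin n)), Simple θ ∧
      θ.character ⟨x, hx⟩ = 0 ∧
      ∃ Θ : FDRep ℂ (Equiv.Perm (Fin n)), Simple Θ ∧
        ∀ y (hy : y ∈ alternatingGroup (Fin n)),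
          Θ.character y = θ.character ⟨y, hy⟩ := by
  have hcard : Fintype.card (Equiv.Perm (Fin n)) = Nat.factorial n := by
    rw [Fintype.card_perm, Fintype.card_fin]
  have hsum' : ∑ g, (φ g : ℂ) * (φ g⁻¹ : ℂ) = (Fintype.card (Equiv.Perm (Fin n)) : ℂ) := by
    simp_rw [hinv, ← pow_two]
    rw [hcard]
    exact_mod_cast congrArg (fun r : ℝ => (r : ℂ)) hsum
  obtain ⟨Θ, hΘ⟩ := virt _ ρ σ rfl (by simp_rw [hφ]; exact hsum') (by
    have h1 := hφ 1
    rw [Representation.char_one, Representation.char_one] at h1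
    have h2 : (Module.finrank ℂ V : ℝ) - Module.finrank ℂ W = φ 1 := by exact_mod_cast h1
    have h3 : (Module.finrank ℂ W : ℝ) < Module.finrank ℂ V := by linarith
    exact_mod_cast h3)
  have hΘ' : ∀ g, Θ.character g = (φ g : ℂ) := fun g => (hΘ g).trans (hφ g)
  have hS : Simple Θ := by
    rw [FDRep.simple_iff_char_is_norm_one]
    simp_rw [hΘ']
    rw [hsum']
    simp
  let τ : Representation ℂ (alternatingGroup (Fin n)) Θ :=
    Θ.ρ.comp (alternatingGroup (Fin n)).subtype
  have hτ : ∀ g, τ.character g = (φ g : ℂ) := fun g => hΘ' g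
  have hθ : ∀ g, (FDRep.of τ).character g = (φ g : ℂ) := fun g => hΘ' g
  have hAcard : Fintype.card (Equiv.Perm (Fin n)) =
      2 * Fintype.card (alternatingGroup (Fin n)) := by
    have : Nontrivial (Fin n) := Fin.nontrivial_iff_two_le.2 (by omega)
    exact two_mul_card_alternatingGroup.symm
  have hd := hom_sum τ τ
  simp_rw [hτ] at hd
  have hd' : ∑ g : alternatingGroup (Fin n), φ g ^ 2 =
     (Fintype.card (alternatingGroup (Fin n)) : ℝ) *
       Module.finrank ℂ (Representation.IntertwiningMap τ τ) := by
    have : ∀ g : alternatingGroup (Fin n), (φ g : ℂ) * (φ (g⁻¹ : alternatingGroup (Fin n)) : ℂ)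
      = ((φ g ^ 2 : ℝ) : ℂ) := by
      intro g
      rw [Subgroup.coe_inv, hinv]; push_cast; ring
    simp_rw [this] at hd
    exact_mod_cast hd
  have hlt : ∑ g : alternatingGroup (Fin n), φ g ^ 2 < ∑ g, φ g ^ 2 := by
    have := Finset.sum_map (Finset.univ : Finset (alternatingGroup (Fin n)))
      (Function.Embedding.subtype _) (fun g => φ g ^ 2)
    simp only [Function.Embedding.subtype_apply] at this
    rw [← this]
    refine Finset.sum_lt_sum_of_subset (Finset.subset_univ _) (Finset.mem_univ s) ?_ ?_ ?_
    · simpa using hs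
    · positivity
    · intros; positivity
  have hpos' : 0 < ∑ g : alternatingGroup (Fin n), φ g ^ 2 := by
    refine Finset.sum_pos' (fun _ _ => sq_nonneg _) ⟨1, Finset.mem_univ _, ?_⟩
    rw [Subgroup.coe_one]; positivity
  rw [hsum, ← hcard, hAcard, hd'] at hlt
  rw [hd'] at hpos'
  have hA0 : (0 : ℝ) < Fintype.card (alternatingGroup (Fin n)) := by
    exact_mod_cast Fintype.card_pos
  have h1 : Module.finrank ℂ (Representation.IntertwiningMap τ τ) < 2 := by
    push_cast at hlt
    rw [mul_comm] at hlt
    exact_mod_cast lt_of_mul_lt_mul_right hlt hA0.le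
  have h2 : 0 < Module.finrank ℂ (Representation.IntertwiningMap τ τ) := by
    exact_mod_cast pos_of_mul_pos_right hpos' hA0.le
  have h3 : Module.finrank ℂ (Representation.IntertwiningMap τ τ) = 1 := by omega
  refine ⟨FDRep.of τ, ?_, ?_, Θ, hS, ?_⟩
  · rw [FDRep.simple_iff_char_is_norm_one]
    simp_rw [hθ]
    rw [hd, h3]
    simp
  · rw [hθ, hxφ]; simp
  · intro y hy
    rw [hΘ', hθ]

section
variable {G : Type} [Group G]

theorem trace_funLeft {X : Type} [Fintype X] [DecidableEq X] (p : X → X) :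
    LinearMap.trace ℂ (X → ℂ) (LinearMap.funLeft ℂ ℂ p) =
      (Fintype.card {x // p x = x} : ℂ) := by
  rw [LinearMap.trace_eq_matrix_trace ℂ (Pi.basisFun ℂ X), Matrix.trace, Fintype.card_subtype,
    Finset.card_filter]
  push_cast
  refine Finset.sum_congr rfl fun x _ => ?_
  simp [LinearMap.funLeft_apply, Pi.single_apply]

/-- the permutation representation on functions -/
noncomputable def permRep {X : Type} (π : G →* Equiv.Perm X) : Representation ℂ G (X → ℂ) where
  toFun g := LinearMap.funLeft ℂ ℂ (π g⁻¹)
  map_one' := by ext; simp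
  map_mul' a b := by
    apply LinearMap.ext; intro f; funext x
    simp [LinearMap.funLeft_apply]

theorem permRep_apply {X : Type} (π : G →* Equiv.Perm X) (g : G) (f : X → ℂ) (x : X) :
    permRep π g f x = f (π g⁻¹ x) := rfl

theorem permRep_char {X : Type} [Fintype X] [DecidableEq X] (π : G →* Equiv.Perm X) (g : G) :
    (permRep π).character g = (Fintype.card {x // π g x = x} : ℂ) := by
  have : (permRep π).character g = LinearMap.trace ℂ (X → ℂ) (LinearMap.funLeft ℂ ℂ (π g⁻¹)) := rfl
  rw [this, trace_funLeft]
  congr 1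
  refine Fintype.card_congr (Equiv.subtypeEquivRight fun x => ?_)
  rw [map_inv, Equiv.Perm.inv_eq_iff_eq, eq_comm]

theorem prod_char {V W : Type} [AddCommGroup V] [Module ℂ V] [FiniteDimensional ℂ V]
    [AddCommGroup W] [Module ℂ W] [FiniteDimensional ℂ W]
    (ρ : Representation ℂ G V) (σ : Representation ℂ G W) (g : G) :
    (ρ.prod σ).character g = ρ.character g + σ.character g := by
  unfold Representation.character
  exact LinearMap.trace_prodMap' _ _

/-- The `ζ`-twisted invariants of a commuting symmetry `c` of order dividing `r`. -/
theorem eigen_rep {X : Type} [Fintype X] [DecidableEq X] (π : G →* Equiv.Perm X)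
    (c : Equiv.Perm X) (hc : ∀ g x, c (π g x) = π g (c x)) (r : ℕ) (hr : r ≠ 0)
    (hcr : c ^ r = 1) (ζ : ℂ) (hζ : ζ ^ r = 1) :
    ∃ (N : Submodule ℂ (X → ℂ)) (τ : Representation ℂ G N), ∀ g,
      τ.character g = (r : ℂ)⁻¹ * ∑ i ∈ Finset.range r, ζ ^ i *
        (Fintype.card {x // π g x = (c ^ i) x} : ℂ) := by
  let N : Submodule ℂ (X → ℂ) := 
    { carrier := {f | ∀ x, ζ * f (c x) = f x}
      add_mem' := by
        intro a b ha hb x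
        simp only [Set.mem_ofPred_eq, Pi.add_apply] at *
        rw [mul_add, ha, hb]
      zero_mem' := by intro x; simp
      smul_mem' := by
        intro k a ha x
        simp only [Set.mem_ofPred_eq, Pi.smul_apply, smul_eq_mul] at *
        rw [← ha x]; ring }
  have hN : ∀ g, N ≤ N.comap (permRep π g) := by
    intro g f hf x
    rw [permRep_apply, permRep_apply, ← hc]
    exact hf _
  refine ⟨N, (permRep π).subrepresentation N hN, fun g => ?_⟩
  let p : (X → ℂ) →ₗ[ℂ] (X → ℂ) :=
    (r : ℂ)⁻¹ • ∑ i ∈ Finset.range r, ζ ^ i • LinearMap.funLeft ℂ ℂ (c ^ i : Equiv.Perm X)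
  have hpa : ∀ f x, p f x = (r : ℂ)⁻¹ * ∑ i ∈ Finset.range r, ζ ^ i * f ((c ^ i) x) := by
    intro f x
    simp [p, LinearMap.sum_apply, Finset.sum_apply, LinearMap.funLeft_apply]
  have hpN : ∀ f, p f ∈ N := by
    intro f x
    rw [hpa, hpa, mul_left_comm]
    congr 1
    have h1 := Finset.sum_range_succ (fun i => ζ ^ i * f ((c ^ i) x)) r
    rw [Finset.sum_range_succ'] at h1
    simp only [pow_zero, hζ, hcr] at h1
    have h2 := add_right_cancel h1
    rw [← h2, Finset.mul_sum]
    refine Finset.sum_congr rfl fun i _ => ?_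
    rw [pow_succ c, Equiv.Perm.mul_apply]; ring
  have hpid : ∀ f ∈ N, p f = f := by
    intro f hf
    have : ∀ i x, ζ ^ i * f ((c ^ i) x) = f x := by
      intro i
      induction i with
      | zero => intro x; simp
      | succ i ih =>
        intro x
        rw [pow_succ, pow_succ, Equiv.Perm.mul_apply, mul_right_comm, ih, mul_comm]
        exact hf x
    funext x
    rw [hpa]
    simp only [this]
    have : (r : ℂ) ≠ 0 := by exact_mod_cast hr
    simp [this]
  have hq : ∀ f, (permRep π g ∘ₗ p) f ∈ N := fun f => hN g (hpN f)
  have e1 : ((permRep π).subrepresentation N hN).character g =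
      LinearMap.trace ℂ _ (permRep π g ∘ₗ p) := by
    rw [← LinearMap.trace_restrict_eq_of_forall_mem N _ hq]
    unfold Representation.character
    congr 1
    apply LinearMap.ext
    rintro ⟨f, hf⟩
    apply Subtype.ext
    change permRep π g f = permRep π g (p f)
    rw [hpid f hf]
  have e2 : permRep π g ∘ₗ p = (r : ℂ)⁻¹ • ∑ i ∈ Finset.range r,
      ζ ^ i • LinearMap.funLeft ℂ ℂ (fun x => (c ^ i) (π g⁻¹ x)) := by
    apply LinearMap.ext; intro f; funext x
    rw [LinearMap.comp_apply, permRep_apply, hpa]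
    simp [LinearMap.sum_apply, Finset.sum_apply, LinearMap.funLeft_apply]
  rw [e1, e2, map_smul, map_sum, smul_eq_mul]
  congr 1
  refine Finset.sum_congr rfl fun i _ => ?_
  rw [map_smul, smul_eq_mul, trace_funLeft]
  congr 2
  refine Fintype.card_congr ((π g⁻¹).subtypeEquiv fun x => ?_)
  simp [eq_comm]

end

section
variable {n : ℕ}

/-- Embeddings intertwining `σ` and `g`. -/
abbrev Emb {ι : Type} (σ : Equiv.Perm ι) (g : Equiv.Perm (Fin n)) : Type :=
  {e : ι ↪ Fin n // ∀ i, g (e i) = e (σ i)}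

/-- number of fixed points -/
def fx (g : Equiv.Perm (Fin n)) : ℕ := Fintype.card {a // g a = a}

/-- number of points of minimal period r -/
noncomputable def tx (r : ℕ) (g : Equiv.Perm (Fin n)) : ℕ :=
  Fintype.card {a // Function.minimalPeriod g a = r}

theorem sum_emb {ι : Type} [Fintype ι] [DecidableEq ι] (σ : Equiv.Perm ι)
    (h : Fintype.card ι ≤ n) :
    ∑ g : Equiv.Perm (Fin n), Fintype.card (Emb σ g) = Nat.factorial n := by
  have step : ∀ σ : Equiv.Perm ι, ∑ g : Equiv.Perm (Fin n), Fintype.card (Emb σ g) =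
      ∑ e : ι ↪ Fin n, Fintype.card {g : Equiv.Perm (Fin n) // ∀ i, g (e i) = e (σ i)} := by
    intro σ
    simp only [Fintype.card_subtype, Finset.card_filter]
    exact Finset.sum_comm
  have e1 : ∑ g : Equiv.Perm (Fin n), Fintype.card (Emb σ g) =
      ∑ g : Equiv.Perm (Fin n), Fintype.card (Emb (1 : Equiv.Perm ι) g) := by
    rw [step, step]
    refine Finset.sum_congr rfl fun e _ => ?_
    have hv : ∀ i, σ.viaFintypeEmbedding e (e i) = e (σ i) :=
      fun i => Equiv.Perm.viaFintypeEmbedding_apply_image σ e i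
    refine Fintype.card_congr ((Equiv.mulLeft (σ.viaFintypeEmbedding e)⁻¹).subtypeEquiv
      fun g => ?_)
    refine forall_congr' fun i => ?_
    rw [Equiv.coe_mulLeft, Equiv.Perm.mul_apply, Equiv.Perm.inv_eq_iff_eq, Equiv.Perm.one_apply,
      hv]
  rw [e1]
  have htr : ∀ a b : ι ↪ Fin n, ∃ g : Equiv.Perm (Fin n), g • a = b := by
    intro a b
    obtain ⟨g, hg⟩ := Equiv.Perm.exists_smul_eq_embedding
      ((Fintype.equivFin ι).symm.toEmbedding.trans a)
      ((Fintype.equivFin ι).symm.toEmbedding.trans b)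
    refine ⟨g, ?_⟩
    ext i : 1
    have := congrArg (fun e => e (Fintype.equivFin ι i)) hg
    simpa using this
  have : Nonempty (ι ↪ Fin n) := Function.Embedding.nonempty_of_card_le (by simpa using h)
  have : Unique (Quotient (MulAction.orbitRel (Equiv.Perm (Fin n)) (ι ↪ Fin n))) :=
    { default := Quotient.mk _ (Classical.arbitrary _)
      uniq := fun q => by
        induction q using Quotient.inductionOn with
        | _ a => exact Quotient.sound (by
                  obtain ⟨g, hg⟩ := htr (Classical.arbitrary _) a
                  exact ⟨g, hg⟩) }
  have hb := MulAction.sum_card_fixedBy_eq_card_orbits_mul_card_group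
    (Equiv.Perm (Fin n)) (ι ↪ Fin n)
  rw [Fintype.card_unique, one_mul, Fintype.card_perm, Fintype.card_fin] at hb
  rw [← hb]
  refine Finset.sum_congr rfl fun g _ => ?_
  refine Fintype.card_congr (Equiv.subtypeEquivRight fun e => ?_)
  rw [MulAction.mem_fixedBy]
  constructor
  · intro h1
    ext i : 1
    exact h1 i
  · intro h1 i
    exact congrArg (fun e => e i) h1

theorem emb_one_card {j : ℕ} (g : Equiv.Perm (Fin n)) :
    Fintype.card (Emb (1 : Equiv.Perm (Fin j)) g) = (fx g).descFactorial j := by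
  have : Fintype.card (Fin j ↪ {a // g a = a}) = (fx g).descFactorial j := by
    rw [Fintype.card_embedding_eq, Fintype.card_fin, fx]
  rw [← this]
  refine Fintype.card_congr
    { toFun := fun e => ⟨fun i => ⟨e.1 i, e.2 i⟩, fun a b hab =>
        e.1.injective (congrArg Subtype.val hab)⟩
      invFun := fun e => ⟨⟨fun i => (e i).1, fun a b hab => e.injective (Subtype.ext hab)⟩,
        fun i => (e i).2⟩
      left_inv := fun e => rfl
      right_inv := fun e => rfl }

theorem emb_sum_card {ι : Type} [Fintype ι] [DecidableEq ι] (σ : Equiv.Perm ι)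
    (hσ : ∀ i, σ i ≠ i) {j : ℕ} (g : Equiv.Perm (Fin n)) :
    Fintype.card (Emb (Equiv.Perm.sumCongr (1 : Equiv.Perm (Fin j)) σ) g) =
      (fx g).descFactorial j * Fintype.card (Emb σ g) := by
  rw [← emb_one_card, ← Fintype.card_prod]
  refine Fintype.card_congr
    { toFun := fun e => (⟨⟨fun i => e.1 (Sum.inl i), fun a b hab => by
          simpa using e.1.injective hab⟩, fun i => e.2 (Sum.inl i)⟩,
        ⟨⟨fun i => e.1 (Sum.inr i), fun a b hab => by
          simpa using e.1.injective hab⟩, fun i => e.2 (Sum.inr i)⟩)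
      invFun := fun p => ⟨⟨Sum.elim p.1.1 p.2.1, ?_⟩, ?_⟩
      left_inv := fun e => ?_
      right_inv := fun e => rfl }
  · refine Function.Injective.sumElim p.1.1.injective p.2.1.injective fun a b hab => ?_
    have h1 := p.1.2 a
    have h2 := p.2.2 b
    simp only [Equiv.Perm.one_apply] at h1
    rw [← hab, h1, hab] at h2
    exact hσ b (p.2.1.injective h2.symm)
  · rintro (i | i)
    · exact p.1.2 i
    · exact p.2.2 i
  · apply Subtype.ext
    ext (i | i) <;> rfl

/-- rotation -/
def rot (r : ℕ) : Equiv.Perm (ZMod r) := Equiv.addRight 1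

theorem rot_apply (r : ℕ) (i : ZMod r) : rot r i = i + 1 := rfl

theorem emb_rot_iter {r : ℕ} {g : Equiv.Perm (Fin n)} (e : Emb (rot r) g) (i : ZMod r)
    (k : ℕ) : e.1 (i + k) = g^[k] (e.1 i) := by
  induction k with
  | zero => simp
  | succ k ih =>
    rw [Function.iterate_succ_apply', ← ih, e.2, rot_apply]
    push_cast
    rw [add_assoc]

theorem emb_rot_card {r : ℕ} [NeZero r] (g : Equiv.Perm (Fin n)) :
    Fintype.card (Emb (rot r) g) = tx r g := by
  unfold tx
  refine Fintype.card_congr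
    { toFun := fun e => ⟨e.1 0, ?_⟩
      invFun := fun a => ⟨⟨fun k => g^[k.val] a.1, ?_⟩, ?_⟩
      left_inv := fun e => ?_
      right_inv := fun a => ?_ }
  · apply Nat.dvd_antisymm
    · rw [← Function.isPeriodicPt_iff_minimalPeriod_dvd, Function.IsPeriodicPt,
        Function.IsFixedPt, ← emb_rot_iter]
      simp
    · rw [← ZMod.natCast_eq_zero_iff]
      apply e.1.injective
      have := emb_rot_iter e 0 (Function.minimalPeriod g (e.1 0))
      rw [zero_add] at this
      rw [this, Function.iterate_minimalPeriod]
  · intro i j hij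
    have := Function.iterate_injOn_Iio_minimalPeriod (f := g) (x := a.1)
    apply ZMod.val_injective
    refine this ?_ ?_ hij
    · rw [a.2]; exact ZMod.val_lt i
    · rw [a.2]; exact ZMod.val_lt j
  · intro i
    change g (g^[i.val] a.1) = g^[(i + 1).val] a.1
    have h1 := Function.iterate_mod_minimalPeriod_eq (f := g) (x := a.1) (n := (i + 1).val)
    have h2 := Function.iterate_mod_minimalPeriod_eq (f := g) (x := a.1) (n := i.val + 1)
    rw [a.2] at h1 h2
    have h3 : (i + 1).val % r = (i.val + 1) % r := by
      rw [← ZMod.natCast_eq_natCast_iff']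
      simp
    rw [← Function.iterate_succ_apply' g, ← h1, h3, h2]
  · apply Subtype.ext
    ext i : 1
    change g^[i.val] (e.1 0) = e.1 i
    rw [← emb_rot_iter]
    simp
  · apply Subtype.ext
    change g^[(0 : ZMod r).val] a.1 = a.1
    simp

theorem emb_rot_rot_card {r : ℕ} [NeZero r] (g : Equiv.Perm (Fin n)) :
    Fintype.card (Emb (rot r) g) * Fintype.card (Emb (rot r) g) =
      Fintype.card (Emb (Equiv.Perm.sumCongr (rot r) (rot r)) g) +
      Fintype.card (Emb (rot r) g) * r := by
  let F : Emb (Equiv.Perm.sumCongr (rot r) (rot r)) g ⊕ Emb (rot r) g × ZMod r →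
      Emb (rot r) g × Emb (rot r) g := Sum.elim
    (fun e => (⟨⟨fun i => e.1 (Sum.inl i), fun a b hab => by
          simpa using e.1.injective hab⟩, fun i => e.2 (Sum.inl i)⟩,
        ⟨⟨fun i => e.1 (Sum.inr i), fun a b hab => by
          simpa using e.1.injective hab⟩, fun i => e.2 (Sum.inr i)⟩))
    (fun p => (p.1, ⟨⟨fun i => p.1.1 (i + p.2), fun a b hab => by
          simpa using p.1.1.injective hab⟩, fun i => by
            have := p.1.2 (i + p.2)
            refine this.trans ?_
            change p.1.1 (i + p.2 + 1) = p.1.1 (i + 1 + p.2)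
            rw [add_right_comm]⟩))
  have hF : Function.Bijective F := by
    constructor
    · rintro (e | ⟨e, k⟩) (e' | ⟨e', k'⟩) h
      · congr 1
        apply Subtype.ext
        ext (i | i) : 1
        · exact congrArg (fun p => p.1.1 i) h
        · exact congrArg (fun p => p.2.1 i) h
      · exfalso
        have h1 : e.1 (Sum.inl k') = e'.1 k' := congrArg (fun p => p.1.1 k') h
        have h2 : e.1 (Sum.inr 0) = e'.1 (0 + k') := congrArg (fun p => p.2.1 0) h
        rw [zero_add, ← h1] at h2
        simpa using e.1.injective h2
      · exfalso
        have h1 : e.1 k = e'.1 (Sum.inl k) := congrArg (fun p => p.1.1 k) h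
        have h2 : e.1 (0 + k) = e'.1 (Sum.inr 0) := congrArg (fun p => p.2.1 0) h
        rw [zero_add, h1] at h2
        simpa using e'.1.injective h2
      · have h1 : e = e' := congrArg (fun p => p.1) h
        subst h1
        have h2 : e.1 (0 + k) = e.1 (0 + k') := congrArg (fun p => p.2.1 0) h
        have h3 := e.1.injective h2
        simp only [zero_add] at h3
        rw [h3]
    · rintro ⟨a, b⟩
      by_cases hd : ∃ i j, a.1 i = b.1 j
      · obtain ⟨i, j, hij⟩ := hd
        refine ⟨Sum.inr (a, i - j), ?_⟩
        refine Prod.ext rfl (Subtype.ext ?_)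
        ext k : 1
        change a.1 (k + (i - j)) = b.1 k
        have h1 := emb_rot_iter a i (k - j).val
        have h2 := emb_rot_iter b j (k - j).val
        rw [hij, ← h2] at h1
        simp only [ZMod.natCast_val, ZMod.cast_id', id_eq] at h1
        convert h1 using 2 <;> ring
      · push Not at hd
        exact ⟨Sum.inl ⟨⟨Sum.elim a.1 b.1,
          Function.Injective.sumElim a.1.injective b.1.injective hd⟩,
          by rintro (i | i); exacts [a.2 i, b.2 i]⟩, rfl⟩
  have := Fintype.card_of_bijective hF
  rw [Fintype.card_sum, Fintype.card_prod, Fintype.card_prod, ZMod.card] at this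
  exact this.symm

theorem fix_pow_card {r : ℕ} (hr : r.Prime) (g : Equiv.Perm (Fin n)) :
    Fintype.card {a // (g ^ r) a = a} = fx g + tx r g := by
  have : NeZero r := ⟨hr.ne_zero⟩
  unfold fx tx
  rw [Fintype.card_subtype, Fintype.card_subtype, Fintype.card_subtype,
    ← Finset.card_union_of_disjoint]
  · congr 1
    ext a
    simp only [Finset.mem_filter, Finset.mem_univ, true_and, Finset.mem_union]
    have h1 : (g ^ r) a = a ↔ Function.IsPeriodicPt g r a := by
      rw [Function.IsPeriodicPt, Function.IsFixedPt, Equiv.Perm.iterate_eq_pow]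
    rw [h1, Function.isPeriodicPt_iff_minimalPeriod_dvd, Nat.dvd_prime hr,
      Function.minimalPeriod_eq_one_iff_isFixedPt]
    rfl
  · rw [Finset.disjoint_left]
    intro a ha hb
    simp only [Finset.mem_filter, Finset.mem_univ, true_and] at ha hb
    have := Function.minimalPeriod_eq_one_iff_isFixedPt.2 (show Function.IsFixedPt g a from ha)
    exact hr.one_lt.ne (this.symm.trans hb)

end

section
variable {n : ℕ}

theorem mom_f (j : ℕ) (h : j ≤ n) :
    ∑ g : Equiv.Perm (Fin n), ((fx g).descFactorial j : ℝ) = (Nat.factorial n : ℝ) := by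
  have := sum_emb (n := n) (1 : Equiv.Perm (Fin j)) (by simpa using h)
  rw [← this]
  push_cast
  refine Finset.sum_congr rfl fun g _ => ?_
  rw [← emb_one_card]
  congr!

theorem mom_ft (j r : ℕ) (hr : 2 ≤ r) (h : j + r ≤ n) :
    ∑ g : Equiv.Perm (Fin n), ((fx g).descFactorial j : ℝ) * tx r g = (Nat.factorial n : ℝ) := by
  have : NeZero r := ⟨by omega⟩
  have : Fact (1 < r) := ⟨by omega⟩
  have := sum_emb (n := n) (Equiv.Perm.sumCongr (1 : Equiv.Perm (Fin j)) (rot r))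
    (by simpa [ZMod.card] using h)
  simp_rw [emb_sum_card (rot r) (fun i => by simp [rot_apply]), emb_rot_card] at this
  exact_mod_cast this

theorem mom_tt (r : ℕ) (hr : 2 ≤ r) (h : r + r ≤ n) :
    ∑ g : Equiv.Perm (Fin n), (tx r g : ℝ) ^ 2 = ((r : ℝ) + 1) * (Nat.factorial n : ℝ) := by
  have : NeZero r := ⟨by omega⟩
  have h1 := sum_emb (n := n) (Equiv.Perm.sumCongr (rot r) (rot r))
    (by simpa [ZMod.card] using h)
  have h2 : ∀ g : Equiv.Perm (Fin n), (tx r g : ℝ) ^ 2 =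
    Fintype.card (Emb (Equiv.Perm.sumCongr (rot r) (rot r)) g) + (r : ℝ) * tx r g := by
    intro g
    have := emb_rot_rot_card (r := r) g
    rw [emb_rot_card] at this
    have h3 : (tx r g : ℝ) * tx r g =
      Fintype.card (Emb (Equiv.Perm.sumCongr (rot r) (rot r)) g) + (tx r g : ℝ) * r := by
      exact_mod_cast this
    rw [pow_two, h3]; ring
  have h4 := mom_ft (n := n) 0 r hr (by omega)
  simp only [Nat.descFactorial_zero, Nat.cast_one, one_mul] at h4
  simp_rw [h2]
  rw [Finset.sum_add_distrib, ← Finset.mul_sum, h4, ← Nat.cast_sum, h1]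
  ring

theorem desc_succ (f j : ℕ) :
    ((f.descFactorial (j + 1) : ℕ) : ℝ) = ((f : ℝ) - j) * f.descFactorial j := by
  rw [Nat.descFactorial_succ]
  by_cases h : j ≤ f
  · push_cast [Nat.cast_sub h]; ring
  · rw [Nat.descFactorial_of_lt (by omega)]; simp

/-- fixed points of the power -/
def fp (r : ℕ) (g : Equiv.Perm (Fin n)) : ℕ := Fintype.card {a // (g ^ r) a = a}

theorem fx_inv (g : Equiv.Perm (Fin n)) : fx g⁻¹ = fx g := by
  unfold fx
  refine Fintype.card_congr (Equiv.subtypeEquivRight fun x => ?_)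
  rw [Equiv.Perm.inv_eq_iff_eq, eq_comm]

theorem fp_inv (r : ℕ) (g : Equiv.Perm (Fin n)) : fp r g⁻¹ = fp r g := by
  have := fx_inv (g ^ r)
  rw [← inv_pow] at this
  exact this

theorem fp_eq {r : ℕ} (hr : r.Prime) (g : Equiv.Perm (Fin n)) :
    (fp r g : ℝ) = fx g + tx r g := by
  exact_mod_cast fix_pow_card hr g

theorem norm1 (hn : 7 ≤ n) :
    ∑ g : Equiv.Perm (Fin n), ((fx g : ℝ) - 1) ^ 2 = (Nat.factorial n : ℝ) := by
  have e : ∀ g : Equiv.Perm (Fin n), ((fx g : ℝ) - 1) ^ 2 = (fx g).descFactorial 2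
      - (fx g).descFactorial 1 + (fx g).descFactorial 0 := by
    intro g
    simp only [desc_succ, Nat.descFactorial_zero]
    push_cast; ring
  simp_rw [e, Finset.sum_add_distrib, Finset.sum_sub_distrib]
  rw [mom_f 2 (by omega), mom_f 1 (by omega), mom_f 0 (by omega)]
  ring

theorem norm2 (hn : 7 ≤ n) :
    ∑ g : Equiv.Perm (Fin n), (((fx g : ℝ) ^ 2 + fp 2 g) / 2 - 2 * fx g) ^ 2 =
      (Nat.factorial n : ℝ) := by
  have e : ∀ g : Equiv.Perm (Fin n), (((fx g : ℝ) ^ 2 + fp 2 g) / 2 - 2 * fx g) ^ 2 =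
      (1 / 4) * (fx g).descFactorial 4 + (-1 / 2) * (fx g).descFactorial 2
      + (fx g).descFactorial 1 + (1 / 2) * ((fx g).descFactorial 2 * tx 2 g)
      + (-1) * ((fx g).descFactorial 1 * tx 2 g) + (1 / 4) * (tx 2 g : ℝ) ^ 2 := by
    intro g
    rw [fp_eq Nat.prime_two]
    simp only [desc_succ, Nat.descFactorial_zero]
    push_cast; ring
  simp_rw [e, Finset.sum_add_distrib, ← Finset.mul_sum]
  rw [mom_f 4 (by omega), mom_f 2 (by omega), mom_f 1 (by omega),
    mom_ft 2 2 le_rfl (by omega), mom_ft 1 2 le_rfl (by omega), mom_tt 2 le_rfl (by omega)]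
  push_cast; ring

theorem norm3 (hn : 7 ≤ n) :
    ∑ g : Equiv.Perm (Fin n), (((fx g : ℝ) ^ 3 - fp 3 g) / 3 + 3 * fx g - 2 * fx g ^ 2) ^ 2 =
      (Nat.factorial n : ℝ) := by
  have e : ∀ g : Equiv.Perm (Fin n),
      (((fx g : ℝ) ^ 3 - fp 3 g) / 3 + 3 * fx g - 2 * fx g ^ 2) ^ 2 =
      (1 / 9) * (fx g).descFactorial 6 + (1 / 3) * (fx g).descFactorial 5
      + (-1 / 3) * (fx g).descFactorial 4 + (2 / 3) * (fx g).descFactorial 3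
      + (-1) * (fx g).descFactorial 2 + (fx g).descFactorial 1
      + (-2 / 9) * ((fx g).descFactorial 3 * tx 3 g)
      + (2 / 3) * ((fx g).descFactorial 2 * tx 3 g)
      + (-2 / 3) * ((fx g).descFactorial 1 * tx 3 g) + (1 / 9) * (tx 3 g : ℝ) ^ 2 := by
    intro g
    rw [fp_eq Nat.prime_three]
    simp only [desc_succ, Nat.descFactorial_zero]
    push_cast; ring
  simp_rw [e, Finset.sum_add_distrib, ← Finset.mul_sum]
  rw [mom_f 6 (by omega), mom_f 5 (by omega), mom_f 4 (by omega), mom_f 3 (by omega),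
    mom_f 2 (by omega), mom_f 1 (by omega), mom_ft 3 3 (by omega) (by omega),
    mom_ft 2 3 (by omega) (by omega), mom_ft 1 3 (by omega) (by omega),
    mom_tt 3 (by omega) (by omega)]
  push_cast; ring

/-- the natural representation -/
noncomputable abbrev P1 (n : ℕ) := permRep (MonoidHom.id (Equiv.Perm (Fin n)))

theorem P1_char (g : Equiv.Perm (Fin n)) : (P1 n).character g = fx g := permRep_char _ g

/-- the representation on pairs -/
noncomputable abbrev P2 (n : ℕ) :=
  permRep (MulAction.toPermHom (Equiv.Perm (Fin n)) (Fin n × Fin n))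

theorem pair_fix (g : Equiv.Perm (Fin n)) :
    Fintype.card {p : Fin n × Fin n //
      MulAction.toPermHom (Equiv.Perm (Fin n)) (Fin n × Fin n) g p = p} = fx g ^ 2 := by
  rw [pow_two, fx, ← Fintype.card_prod]
  refine Fintype.card_congr
    { toFun := fun p => (⟨p.1.1, congrArg Prod.fst p.2⟩, ⟨p.1.2, congrArg Prod.snd p.2⟩)
      invFun := fun q => ⟨(q.1.1, q.2.1), Prod.ext q.1.2 q.2.2⟩
      left_inv := fun _ => rfl
      right_inv := fun _ => rfl }

theorem P2_char (g : Equiv.Perm (Fin n)) : (P2 n).character g = (fx g : ℂ) ^ 2 := by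
  rw [permRep_char, pair_fix]; push_cast; rfl

theorem pair_swap (g : Equiv.Perm (Fin n)) :
    Fintype.card {p : Fin n × Fin n //
      MulAction.toPermHom (Equiv.Perm (Fin n)) (Fin n × Fin n) g p =
        (Equiv.prodComm (Fin n) (Fin n)) p} = fp 2 g := by
  refine Fintype.card_congr
    { toFun := fun p => ⟨p.1.1, ?_⟩
      invFun := fun a => ⟨(a.1, g a.1), Prod.ext rfl a.2⟩
      left_inv := fun p => Subtype.ext (Prod.ext rfl (congrArg Prod.fst p.2))
      right_inv := fun _ => rfl }
  have h1 : g p.1.1 = p.1.2 := congrArg Prod.fst p.2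
  have h2 : g p.1.2 = p.1.1 := congrArg Prod.snd p.2
  rw [pow_two, Equiv.Perm.mul_apply, h1, h2]

theorem sym_rep (n : ℕ) : ∃ (N : Submodule ℂ (Fin n × Fin n → ℂ))
    (τ : Representation ℂ (Equiv.Perm (Fin n)) N),
    ∀ g, τ.character g = ((fx g : ℂ) ^ 2 + fp 2 g) / 2 := by
  obtain ⟨N, τ, h⟩ := eigen_rep (MulAction.toPermHom (Equiv.Perm (Fin n)) (Fin n × Fin n))
    (Equiv.prodComm (Fin n) (Fin n)) (fun _ _ => rfl) 2 (by norm_num) (by ext <;> rfl) 1 (by simp)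
  refine ⟨N, τ, fun g => ?_⟩
  rw [h, Finset.sum_range_succ, Finset.sum_range_one]
  simp only [pow_zero, pow_one, Equiv.Perm.one_apply]
  rw [pair_fix, pair_swap]
  push_cast; ring

/-- rotation of triples -/
def rot3 (n : ℕ) : Equiv.Perm (Fin n × Fin n × Fin n) where
  toFun p := (p.2.1, p.2.2, p.1)
  invFun p := (p.2.2, p.1, p.2.1)
  left_inv _ := rfl
  right_inv _ := rfl

theorem triple_fix (g : Equiv.Perm (Fin n)) :
    Fintype.card {p : Fin n × Fin n × Fin n //
      MulAction.toPermHom (Equiv.Perm (Fin n)) (Fin n × Fin n × Fin n) g p = p} = fx g ^ 3 := by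
  have : fx g ^ 3 = fx g * (fx g * fx g) := by ring
  rw [this, fx, ← Fintype.card_prod, ← Fintype.card_prod]
  refine Fintype.card_congr
    { toFun := fun p => (⟨p.1.1, congrArg Prod.fst p.2⟩,
        ⟨p.1.2.1, congrArg (fun q => q.2.1) p.2⟩, ⟨p.1.2.2, congrArg (fun q => q.2.2) p.2⟩)
      invFun := fun q => ⟨(q.1.1, q.2.1.1, q.2.2.1),
        Prod.ext q.1.2 (Prod.ext q.2.1.2 q.2.2.2)⟩
      left_inv := fun _ => rfl
      right_inv := fun _ => rfl }

theorem triple_rot (g : Equiv.Perm (Fin n)) :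
    Fintype.card {p : Fin n × Fin n × Fin n //
      MulAction.toPermHom (Equiv.Perm (Fin n)) (Fin n × Fin n × Fin n) g p = rot3 n p} =
        fp 3 g := by
  refine Fintype.card_congr
    { toFun := fun p => ⟨p.1.1, ?_⟩
      invFun := fun a => ⟨(a.1, g a.1, g (g a.1)), Prod.ext rfl (Prod.ext rfl a.2)⟩
      left_inv := fun p => ?_
      right_inv := fun _ => rfl }
  · have h1 : g p.1.1 = p.1.2.1 := congrArg Prod.fst p.2
    have h2 : g p.1.2.1 = p.1.2.2 := congrArg (fun q => q.2.1) p.2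
    have h3 : g p.1.2.2 = p.1.1 := congrArg (fun q => q.2.2) p.2
    change g (g (g p.1.1)) = p.1.1
    rw [h1, h2, h3]
  · have h1 : g p.1.1 = p.1.2.1 := congrArg Prod.fst p.2
    have h2 : g p.1.2.1 = p.1.2.2 := congrArg (fun q => q.2.1) p.2
    refine Subtype.ext (Prod.ext rfl (Prod.ext h1 ?_))
    change g (g p.1.1) = p.1.2.2
    rw [h1, h2]

theorem triple_rot' (g : Equiv.Perm (Fin n)) :
    Fintype.card {p : Fin n × Fin n × Fin n //
      MulAction.toPermHom (Equiv.Perm (Fin n)) (Fin n × Fin n × Fin n) g p =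
        (rot3 n ^ 2) p} = fp 3 g := by
  refine Fintype.card_congr
    { toFun := fun p => ⟨p.1.1, ?_⟩
      invFun := fun a => ⟨(a.1, g (g a.1), g a.1), Prod.ext rfl (Prod.ext a.2 rfl)⟩
      left_inv := fun p => ?_
      right_inv := fun _ => rfl }
  · have h1 : g p.1.1 = p.1.2.2 := congrArg Prod.fst p.2
    have h2 : g p.1.2.1 = p.1.1 := congrArg (fun q => q.2.1) p.2
    have h3 : g p.1.2.2 = p.1.2.1 := congrArg (fun q => q.2.2) p.2
    change g (g (g p.1.1)) = p.1.1
    rw [h1, h3, h2]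
  · have h1 : g p.1.1 = p.1.2.2 := congrArg Prod.fst p.2
    have h3 : g p.1.2.2 = p.1.2.1 := congrArg (fun q => q.2.2) p.2
    refine Subtype.ext (Prod.ext rfl (Prod.ext ?_ h1))
    change g (g p.1.1) = p.1.2.1
    rw [h1, h3]

theorem schur_rep (n : ℕ) : ∃ (N : Submodule ℂ (Fin n × Fin n × Fin n → ℂ))
    (τ : Representation ℂ (Equiv.Perm (Fin n)) N),
    ∀ g, τ.character g = ((fx g : ℂ) ^ 3 - fp 3 g) / 3 := by
  have hprim := Complex.isPrimitiveRoot_exp 3 (by norm_num)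
  set ω := Complex.exp (2 * Real.pi * Complex.I / (3 : ℕ)) with hω
  have hgeom := hprim.geom_sum_eq_zero (by norm_num)
  obtain ⟨N, τ, h⟩ := eigen_rep
    (MulAction.toPermHom (Equiv.Perm (Fin n)) (Fin n × Fin n × Fin n))
    (rot3 n) (fun _ _ => rfl) 3 (by norm_num) (by ext <;> rfl) ω hprim.pow_eq_one
  refine ⟨N, τ, fun g => ?_⟩
  rw [Finset.sum_range_succ, Finset.sum_range_succ, Finset.sum_range_one] at hgeom
  rw [h, Finset.sum_range_succ, Finset.sum_range_succ, Finset.sum_range_one]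
  simp only [pow_zero, pow_one, Equiv.Perm.one_apply] at hgeom ⊢
  rw [triple_fix, triple_rot, triple_rot']
  push_cast
  linear_combination (fp 3 g : ℂ) / 3 * hgeom

theorem fx_support (g : Equiv.Perm (Fin n)) : fx g + g.support.card = n := by
  have h := Finset.card_filter_add_card_filter_not (s := (Finset.univ : Finset (Fin n)))
    (fun a => g a = a)
  rw [Finset.card_univ, Fintype.card_fin] at h
  rw [fx, Fintype.card_subtype]
  exact h

theorem fp_zero {k t r : ℕ} (x : Equiv.Perm (Fin n))
    (hc : x.cycleType = Multiset.replicate k t) (h0 : fx x = 0) (htr : ¬ t ∣ r) :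
    fp r x = 0 := by
  unfold fp
  rw [Fintype.card_eq_zero_iff]
  refine ⟨fun ⟨a, ha⟩ => htr ?_⟩
  have hxa : x a ≠ a := by
    intro h
    unfold fx at h0
    rw [Fintype.card_eq_zero_iff] at h0
    exact h0.false ⟨a, h⟩
  have hcyc : (x.cycleOf a).IsCycle := x.isCycle_cycleOf hxa
  have hmem : (x.cycleOf a).support.card ∈ x.cycleType := by
    rw [Equiv.Perm.cycleType_def]
    exact Multiset.mem_map_of_mem _ (Finset.mem_def.1 <|
      Equiv.Perm.cycleOf_mem_cycleFactorsFinset_iff.2 (Equiv.Perm.mem_support.2 hxa))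
  rw [hc] at hmem
  rw [← Multiset.eq_of_mem_replicate hmem, ← hcyc.orderOf, orderOf_dvd_iff_pow_eq_one,
    hcyc.pow_eq_one_iff]
  refine ⟨a, ?_, ?_⟩
  · simpa using hxa
  · rw [Equiv.Perm.cycleOf_pow_apply_self, ha]

end

open CategoryTheory

theorem stmt_6 (n t : ℕ) (hn : 7 ≤ n) (ht : 2 ≤ t)
    (x : Equiv.Perm (Fin n)) (hx : x ∈ alternatingGroup (Fin n))
    (htype : ∃ k, x.cycleType = Multiset.replicate k t ∧ (n = k * t ∨ n = k * t + 1)) :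
    ∃ θ : FDRep ℂ (alternatingGroup (Fin n)), Simple θ ∧
      θ.character ⟨x, hx⟩ = 0 ∧
      ∃ Θ : FDRep ℂ (Equiv.Perm (Fin n)), Simple Θ ∧
        ∀ y (hy : y ∈ alternatingGroup (Fin n)),
          Θ.character y = θ.character ⟨y, hy⟩ := by
  obtain ⟨k, hc, hk⟩ := htype
  have hsupp : x.support.card = k * t := by
    rw [← Equiv.Perm.sum_cycleType, hc, Multiset.sum_replicate, smul_eq_mul]
  have hfx := fx_support x
  -- an odd permutation
  let s : Equiv.Perm (Fin n) := Equiv.swap ⟨0, by omega⟩ ⟨1, by omega⟩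
  have hne : (⟨0, by omega⟩ : Fin n) ≠ ⟨1, by omega⟩ := by simp
  have hs : s ∉ alternatingGroup (Fin n) := by
    rw [Equiv.Perm.mem_alternatingGroup, Equiv.Perm.sign_swap hne]
    decide
  have hs2 : s ^ 2 = 1 := by rw [pow_two]; exact Equiv.swap_mul_self _ _
  have hfs : fx s = n - 2 := by
    have := fx_support s
    rw [Equiv.Perm.card_support_swap hne] at this
    omega
  have hfs' : (fx s : ℝ) = n - 2 := by rw [hfs, Nat.cast_sub (by omega)]; norm_num
  have hf1 : fx (1 : Equiv.Perm (Fin n)) = n := by simp [fx]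
  have hp1 : ∀ r, fp r (1 : Equiv.Perm (Fin n)) = n := by intro r; simp [fp]
  have hn' : (7 : ℝ) ≤ n := by exact_mod_cast hn
  rcases hk with hk | hk
  · have h0 : fx x = 0 := by omega
    by_cases ht2 : t = 2
    · -- the partition (n-3,2,1)
      obtain ⟨N, τ, hτ⟩ := schur_rep n
      refine reduce n hn (τ.prod ((P1 n).prod ((P1 n).prod (P1 n)))) ((P2 n).prod (P2 n))
        (fun g => ((fx g : ℝ) ^ 3 - fp 3 g) / 3 + 3 * fx g - 2 * fx g ^ 2) ?_ ?_ (norm3 hn)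
        ?_ s hs ?_ x hx ?_
      · intro g
        simp only [prod_char, hτ, P1_char, P2_char]
        push_cast; ring
      · intro g
        simp only [fx_inv, fp_inv]
      · simp only [hf1, hp1]
        have : (0 : ℝ) < n * (n - 2) * (n - 4) / 3 := by
          have h1 : (0 : ℝ) < n := by linarith
          have h2 : (0 : ℝ) < n - 2 := by linarith
          have h3 : (0 : ℝ) < n - 4 := by linarith
          positivity
        linarith
      · have h3 : fp 3 s = fx s := by
          unfold fp fx
          rw [pow_succ, hs2, one_mul]
        simp only [h3, hfs']
        have : (0 : ℝ) < (n - 2) * (n - 4) * (n - 6) / 3 := by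
          have h1 : (0 : ℝ) < n - 6 := by linarith
          have h2 : (0 : ℝ) < n - 2 := by linarith
          have h3 : (0 : ℝ) < n - 4 := by linarith
          positivity
        apply ne_of_gt
        linarith
      · have h3 : fp 3 x = 0 := fp_zero x hc h0 (by rw [ht2]; decide)
        simp [h3, h0]
    · -- the partition (n-2,2)
      obtain ⟨N, τ, hτ⟩ := sym_rep n
      refine reduce n hn τ ((P1 n).prod (P1 n))
        (fun g => ((fx g : ℝ) ^ 2 + fp 2 g) / 2 - 2 * fx g) ?_ ?_ (norm2 hn)
        ?_ s hs ?_ x hx ?_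
      · intro g
        simp only [prod_char, hτ, P1_char]
        push_cast; ring
      · intro g
        simp only [fx_inv, fp_inv]
      · simp only [hf1, hp1]
        nlinarith
      · have h3 : fp 2 s = n := by
          unfold fp
          rw [hs2]; simp
        simp only [h3, hfs']
        apply ne_of_gt
        nlinarith
      · have h3 : fp 2 x = 0 := fp_zero x hc h0 (fun h => by
          have := Nat.le_of_dvd (by norm_num) h
          omega)
        simp [h3, h0]
  · -- the partition (n-1,1)
    have h1 : fx x = 1 := by omega
    refine reduce n hn (P1 n) (Representation.trivial ℂ (Equiv.Perm (Fin n)) ℂ)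
      (fun g => (fx g : ℝ) - 1) ?_ ?_ (norm1 hn) ?_ s hs ?_ x hx ?_
    · intro g
      rw [P1_char]
      have : (Representation.trivial ℂ (Equiv.Perm (Fin n)) ℂ).character g =
        LinearMap.trace ℂ ℂ LinearMap.id := rfl
      rw [this, LinearMap.trace_id]
      simp
    · intro g
      simp only [fx_inv]
    · simp only [hf1]; linarith
    · simp only [hfs']
      apply ne_of_gt
      linarith
    · simp [h1]
end

section
/- Let G be a finite group, M and N normal subgroups of G with M ∩ N = 1. If m ∈ M is a vanishing element of G, then mn is a vanishing element of G for every n ∈ N. -/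
open CategoryTheory

/-- `g` is a vanishing element of `H`: some irreducible complex character of `H`
vanishes at `g`. -/
def IsVanishing (H : Type) [Group H] [Fintype H] (g : H) : Prop :=
  ∃ V : FDRep ℂ H, Simple V ∧ V.character g = 0

open scoped MonoidAlgebra

/-- The `G`-class sum (with multiplicity) of `m` in the complex group algebra. -/
noncomputable def clsSum (G : Type) [Group G] [Fintype G] (m : G) : ℂ[G] :=
  ∑ g : G, MonoidAlgebra.of ℂ G (g * m * g⁻¹)

theorem clsSum_comm_of {G : Type} [Group G] [Fintype G] (m h : G) :
    clsSum G m * MonoidAlgebra.of ℂ G h = MonoidAlgebra.of ℂ G h * clsSum G m := by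
  unfold clsSum
  rw [Finset.sum_mul, Finset.mul_sum]
  simp_rw [← map_mul]
  rw [← Equiv.sum_comp (Equiv.mulLeft h)]
  refine Finset.sum_congr rfl fun g _ => ?_
  congr 1
  simp [mul_assoc]

theorem clsSum_comm {G : Type} [Group G] [Fintype G] (m : G) (a : ℂ[G]) :
    clsSum G m * a = a * clsSum G m := by
  induction a using MonoidAlgebra.induction_on with
  | of g => exact clsSum_comm_of m g
  | add a b ha hb => rw [mul_add, add_mul, ha, hb]
  | smul r a ha => rw [mul_smul_comm, smul_mul_assoc, ha]

theorem simple_of_irreducible {G : Type} [Group G] [Fintype G] {W : Type} [AddCommGroup W]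
    [Module ℂ W] [Module.Finite ℂ W] (ρ : Representation ℂ G W) [ρ.IsIrreducible] :
    Simple (FDRep.of ρ) := by
  rw [FDRep.simple_iff_char_is_norm_one]
  have := invertibleOfNonzero (NeZero.ne (Nat.card G : ℂ))
  have h := Representation.char_orthonormal ρ ρ
  have e : Nonempty (Representation.Equiv ρ ρ) := ⟨Representation.Equiv.refl ρ⟩
  simp only [e, if_true] at h
  have h2 : ∑ g : G, ρ.character g * ρ.character g⁻¹ = Nat.card G := by
    rw [inv_mul_eq_one₀ (NeZero.ne _)] at h
    exact h.symm
  exact h2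

theorem clsSum_act {G : Type} [Group G] [Fintype G] {W : Type} [AddCommGroup W]
    [Module ℂ W] (ρ : Representation ℂ G W) (m : G) :
    ρ.asAlgebraHom (clsSum G m) = ∑ g : G, ρ (g * m * g⁻¹) := by
  simp [clsSum, Representation.asAlgebraHom_single]

theorem trace_clsSum {G : Type} [Group G] [Fintype G] {W : Type} [AddCommGroup W]
    [Module ℂ W] (ρ : Representation ℂ G W) (m : G) :
    LinearMap.trace ℂ W (ρ.asAlgebraHom (clsSum G m)) = Fintype.card G * ρ.character m := by
  rw [clsSum_act, map_sum]
  have : ∀ g, LinearMap.trace ℂ W (ρ (g * m * g⁻¹)) = ρ.character m := fun g =>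
    ρ.char_conj m g
  simp only [this, Finset.sum_const, Finset.card_univ, nsmul_eq_mul]

theorem not_isUnit_clsSum {G : Type} [Group G] [Fintype G] (m : G) (h : IsVanishing G m) :
    ¬ IsUnit (clsSum G m) := by
  obtain ⟨V, hV, hc⟩ := h
  intro hu
  have hu' := hu.map (Representation.asAlgebraHom V.ρ)
  let T : V →ₗ[ℂ] V := Representation.asAlgebraHom V.ρ (clsSum G m)
  have hT : ∀ g : G, T ∘ₗ V.ρ g = V.ρ g ∘ₗ T := by
    intro g
    have := congrArg (Representation.asAlgebraHom V.ρ) (clsSum_comm_of m g)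
    simp only [map_mul, Representation.asAlgebraHom_of] at this
    exact this
  let f : V ⟶ V := ⟨InducedCategory.homMk (ModuleCat.ofHom T), fun g ↦ by
    ext1
    exact hT g⟩
  obtain ⟨c, hcf⟩ := (finrank_eq_one_iff_of_nonzero' (𝟙 V) (id_nonzero V)).mp
    (finrank_endomorphism_simple_eq_one ℂ V) f
  have hTc : T = c • LinearMap.id := by
    have := congrArg (fun f : V ⟶ V => f.hom.hom.hom) hcf
    exact this.symm
  have htr : LinearMap.trace ℂ V T = 0 := by
    have := trace_clsSum V.ρ m
    have h0 : Representation.character V.ρ m = 0 := hc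
    rw [h0, mul_zero] at this
    exact this
  have hfr : Module.finrank ℂ V ≠ 0 := by
    intro h0
    have : Subsingleton V := Module.finrank_zero_iff.mp h0
    apply id_nonzero V
    ext x
    exact Subsingleton.elim _ _
  have hc0 : c = 0 := by
    rw [hTc, map_smul, LinearMap.trace_id] at htr
    simpa [hfr] using htr
  have hT0 : T = 0 := by rw [hTc, hc0, zero_smul]
  have : IsUnit (0 : V →ₗ[ℂ] V) := hT0 ▸ hu'
  have h01 := isUnit_zero_iff.mp this
  apply hfr
  have h1 := congrArg (LinearMap.trace ℂ V) h01
  rw [map_zero, LinearMap.trace_one] at h1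
  exact_mod_cast h1.symm

theorem vanish_of_module {G : Type} [Group G] [Fintype G] (Q : Type) [AddCommGroup Q]
    [Module ℂ Q] [Module ℂ[G] Q] [IsScalarTower ℂ ℂ[G] Q] [hQ : IsSimpleModule ℂ[G] Q] (m n : G)
    (hz : ∀ q : Q, clsSum G m • q = 0) (hn : ∀ q : Q, (MonoidAlgebra.of ℂ G n) • q = q) :
    IsVanishing G (m * n) := by
  let ρ : Representation ℂ G Q := Representation.ofModule' Q
  have hact : ∀ (r : ℂ[G]) (q : Q), ρ.asAlgebraHom r q = r • q := by
    intro r q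
    simp [ρ, Representation.asAlgebraHom, Representation.ofModule']
  let e : ρ.asModule ≃ₗ[ℂ[G]] Q :=
    { ρ.asModuleEquiv with
      map_smul' := fun r x => (ρ.asModuleEquiv_map_smul r x).trans (hact r _) }
  have hirr : ρ.IsIrreducible := by
    rw [Representation.irreducible_iff_isSimpleModule_asModule]
    exact IsSimpleModule.congr e
  have hfin : Module.Finite ℂ Q := Module.Finite.trans ℂ[G] _
  have hzact : ρ.asAlgebraHom (clsSum G m) = 0 := by
    ext x
    rw [hact, hz, LinearMap.zero_apply]
  have hnact : ρ n = 1 := by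
    rw [← Representation.asAlgebraHom_of]
    ext x
    rw [hact, hn, Module.End.one_apply]
  refine ⟨FDRep.of ρ, simple_of_irreducible ρ, ?_⟩
  have h1 : ρ.character (m * n) = ρ.character m := by
    simp only [Representation.character, map_mul, hnact, mul_one]
  have h2 := trace_clsSum ρ m
  rw [hzact, map_zero] at h2
  have h3 : ρ.character m = 0 := by
    simpa using h2.symm
  exact h1.trans h3

theorem stmt_11 {G : Type} [Group G] [Fintype G] (M N : Subgroup G) [M.Normal] [N.Normal]
    (hMN : M ⊓ N = ⊥) (m : G) (hm : m ∈ M) (hvan : IsVanishing G m)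
    (n : G) (hn : n ∈ N) :
    IsVanishing G (m * n) := by
  have hz := not_isUnit_clsSum m hvan
  let ι : ℂ[M] →ₐ[ℂ] ℂ[G] := MonoidAlgebra.mapDomainAlgHom ℂ ℂ M.subtype
  let φ : ℂ[G] →ₐ[ℂ] ℂ[G ⧸ N] := MonoidAlgebra.mapDomainAlgHom ℂ ℂ (QuotientGroup.mk' N)
  let zM : ℂ[M] := ∑ g : G, MonoidAlgebra.of ℂ M
    ⟨g * m * g⁻¹, Subgroup.Normal.conj_mem inferInstance m hm g⟩
  have hι : ι zM = clsSum G m := by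
    simp [ι, zM, clsSum]
  have hφι : Function.Injective (fun y => φ (ι y)) := by
    have : ∀ y, φ (ι y) = MonoidAlgebra.mapDomain ((QuotientGroup.mk' N).comp M.subtype) y := by
      intro y
      have := DFunLike.congr_fun (MonoidAlgebra.mapDomainAlgHom_comp (R := ℂ) (A := ℂ)
        M.subtype (QuotientGroup.mk' N)) y
      exact this.symm
    simp_rw [this]
    apply MonoidAlgebra.mapDomain_injective
    intro a b hab
    have h1 : (a : G)⁻¹ * b ∈ N := QuotientGroup.eq.mp hab
    have h2 : (a : G)⁻¹ * b ∈ M ⊓ N := ⟨M.mul_mem (M.inv_mem a.2) b.2, h1⟩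
    rw [hMN, Subgroup.mem_bot, inv_mul_eq_one] at h2
    exact Subtype.ext h2
  have hzM : ¬ IsUnit zM := fun h => hz (hι ▸ h.map ι)
  obtain ⟨y, hy0, hy⟩ : ∃ y : ℂ[M], y ≠ 0 ∧ zM * y = 0 := by
    by_contra! hcon
    apply hzM
    have hinj : Function.Injective (LinearMap.mulLeft ℂ zM) := by
      rw [injective_iff_map_eq_zero]
      intro y hy
      by_contra h
      exact hcon y h hy
    have : FiniteDimensional ℂ ℂ[M] := inferInstance
    obtain ⟨w, hw⟩ := (LinearMap.injective_iff_surjective.mp hinj) 1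
    exact IsUnit.of_mul_eq_one w hw
  let J : Submodule ℂ[G] ℂ[G] := Ideal.comap φ (Ideal.span {φ (clsSum G m)})
  have hJ : J ≠ ⊤ := by
    intro h
    have h1 : (1 : ℂ[G]) ∈ J := h ▸ Submodule.mem_top
    have h2 : φ 1 ∈ Ideal.span {φ (clsSum G m)} := h1
    obtain ⟨a, ha⟩ := Ideal.mem_span_singleton'.mp h2
    apply hy0
    apply hφι
    have : φ (clsSum G m) * φ (ι y) = 0 := by
      rw [← hι, ← map_mul, ← map_mul, hy, map_zero, map_zero]
    calc φ (ι y) = φ 1 * φ (ι y) := by rw [map_one, one_mul]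
      _ = φ (ι 0) := by rw [← ha, mul_assoc, this, mul_zero, map_zero, map_zero]
  obtain ⟨I, hI, hJI⟩ := Ideal.exists_le_maximal J hJ
  have hsimp : IsSimpleModule ℂ[G] (ℂ[G] ⧸ I) := isSimpleModule_iff_isCoatom.mpr hI.out
  have key : ∀ (r : ℂ[G]), (∀ a, r * a ∈ J) → ∀ q : ℂ[G] ⧸ I, r • q = 0 := by
    intro r hr q
    obtain ⟨a, rfl⟩ := Submodule.Quotient.mk_surjective I q
    rw [← Submodule.Quotient.mk_smul, Submodule.Quotient.mk_eq_zero]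
    exact hJI (hr a)
  refine vanish_of_module (ℂ[G] ⧸ I) m n (key _ fun a => ?_) fun q => ?_
  · rw [clsSum_comm]
    exact J.smul_mem a (Ideal.subset_span rfl)
  · have := key (MonoidAlgebra.of ℂ G n - 1) (fun a => by
      change φ _ ∈ Ideal.span _
      have hn1 : φ (MonoidAlgebra.of ℂ G n) = 1 := by
        have : (QuotientGroup.mk' N) n = 1 := (QuotientGroup.eq_one_iff n).mpr hn
        simp only [QuotientGroup.mk'_apply] at this
        simp [φ, this, MonoidAlgebra.one_def]
      rw [map_mul, map_sub, hn1, map_one, sub_self, zero_mul]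
      exact Ideal.zero_mem _) q
    rwa [sub_smul, one_smul, sub_eq_zero] at this
end
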